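/- arXiv:2101.05671 — 2 statements merged into one kernel-verified Lean document; each statement's English description precedes it below -/
import Mathlib

section
/- The endomorphism algebra B := End_A(A ⊕ D(A)) has global dimension exactly 3. -/
/-!
We formalize statements about the algebra `A = kQ/J²`, where `Q` is the quiver
`1 ⇄ 2 ⇄ 3` and `J` is the arrow ideal of the path algebra `kQ`.
The algebra `A` is presented by generators and relations as a quotient of the
free algebra on three vertex idempotents and four arrows.
Right `A`-modules are treated as left modules over `Aᵐᵒᵖ`.
-/

open CategoryTheory Opposite

/-- Generators of the path algebra `kQ`: three vertex idempotents `e i`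
and four arrows `ar a`, where the arrows of `Q` are
`α : 1 → 2`, `β : 2 → 1`, `γ : 2 → 3`, `δ : 3 → 2`. -/
inductive QGen : Type
  | e : Fin 3 → QGen
  | ar : Fin 4 → QGen

/-- The sources of the four arrows `α, β, γ, δ` (vertices `1,2,3` are `0,1,2 : Fin 3`). -/
def arrowSrc : Fin 4 → Fin 3 := ![0, 1, 1, 2]

/-- The targets of the four arrows `α, β, γ, δ`. -/
def arrowTgt : Fin 4 → Fin 3 := ![1, 0, 2, 1]

/-- The defining relations of `A = kQ/J²`: the `e i` are orthogonal idempotents summing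
to `1`, the arrows are compatible with their sources and targets, and any product of
two arrows vanishes (`J² = 0`). -/
inductive ARel (k : Type) [Field k] : FreeAlgebra k QGen → FreeAlgebra k QGen → Prop
  | idem (i j : Fin 3) :
      ARel k (FreeAlgebra.ι k (QGen.e i) * FreeAlgebra.ι k (QGen.e j))
        (if i = j then FreeAlgebra.ι k (QGen.e i) else 0)
  | sum : ARel k
      (FreeAlgebra.ι k (QGen.e 0) + FreeAlgebra.ι k (QGen.e 1) + FreeAlgebra.ι k (QGen.e 2)) 1
  | src (a : Fin 4) :
      ARel k (FreeAlgebra.ι k (QGen.e (arrowSrc a)) * FreeAlgebra.ι k (QGen.ar a))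
        (FreeAlgebra.ι k (QGen.ar a))
  | tgt (a : Fin 4) :
      ARel k (FreeAlgebra.ι k (QGen.ar a) * FreeAlgebra.ι k (QGen.e (arrowTgt a)))
        (FreeAlgebra.ι k (QGen.ar a))
  | radsq (a b : Fin 4) :
      ARel k (FreeAlgebra.ι k (QGen.ar a) * FreeAlgebra.ι k (QGen.ar b)) 0

/-- The algebra `A = kQ/J²`. -/
abbrev AlgA (k : Type) [Field k] : Type := RingQuot (ARel k)

/-- Right `A`-modules are left modules over `Aop k = Aᵐᵒᵖ`. -/
abbrev Aop (k : Type) [Field k] : Type := (AlgA k)ᵐᵒᵖ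

/-- The algebra homomorphism `A → k` corresponding to the vertex `i`. -/
noncomputable def simpleAlgHom (k : Type) [Field k] (i : Fin 3) : AlgA k →ₐ[k] k :=
  RingQuot.liftAlgHom k
    ⟨FreeAlgebra.lift k (fun g => match g with
        | QGen.e j => if j = i then (1 : k) else 0
        | QGen.ar _ => 0), by
      intro _x _y h
      induction h with
      | idem i j =>
          simp only [map_mul, FreeAlgebra.lift_ι_apply, apply_ite, map_zero]
          split_ifs <;> simp_all
      | sum =>
          simp only [map_add, map_one, FreeAlgebra.lift_ι_apply]
          fin_cases i <;> simp
      | src a => simp [FreeAlgebra.lift_ι_apply]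
      | tgt a => simp [FreeAlgebra.lift_ι_apply]
      | radsq a b => simp [FreeAlgebra.lift_ι_apply]⟩

/-- The ring homomorphism `Aᵐᵒᵖ → k` corresponding to the vertex `i`. -/
noncomputable def simpleRingHom (k : Type) [Field k] (i : Fin 3) : Aop k →+* k :=
  RingHom.fromOpposite (simpleAlgHom k i).toRingHom (fun _ _ => mul_comm _ _)

/-- The simple right `A`-module `S_{i+1}` at the vertex `i` (one-dimensional over `k`,
with `e i` acting as the identity and all arrows acting by zero).
So `SimpleS k 0 = S₁`, `SimpleS k 1 = S₂` and `SimpleS k 2 = S₃`. -/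
def SimpleS (k : Type) [Field k] (_i : Fin 3) : Type := k

instance (k : Type) [Field k] (i : Fin 3) : AddCommGroup (SimpleS k i) :=
  inferInstanceAs (AddCommGroup k)

instance (k : Type) [Field k] (i : Fin 3) : Module k (SimpleS k i) :=
  inferInstanceAs (Module k k)

noncomputable instance (k : Type) [Field k] (i : Fin 3) : Module (Aop k) (SimpleS k i) :=
  Module.compHom (SimpleS k i) (simpleRingHom k i)

/-- The underlying type of `D(A) = Hom_k(A, k)`. -/
abbrev DualA (k : Type) [Field k] : Type := AlgA k →ₗ[k] k

/-- The right `A`-module structure on `D(A)`: `(φ · a) x = φ (a * x)`. -/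
noncomputable instance (k : Type) [Field k] : Module (Aop k) (DualA k) where
  smul a φ := φ.comp (LinearMap.mulLeft k a.unop)
  one_smul φ := by
    show φ.comp (LinearMap.mulLeft k ((1 : Aop k).unop)) = φ
    ext x; simp
  mul_smul a b φ := by
    show φ.comp (LinearMap.mulLeft k ((a * b).unop)) =
      (φ.comp (LinearMap.mulLeft k b.unop)).comp (LinearMap.mulLeft k a.unop)
    ext x; simp [mul_assoc]
  smul_zero a := by
    show (0 : DualA k).comp (LinearMap.mulLeft k a.unop) = 0
    ext x; simp
  smul_add a φ ψ := by
    show (φ + ψ).comp (LinearMap.mulLeft k a.unop) =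
      φ.comp (LinearMap.mulLeft k a.unop) + ψ.comp (LinearMap.mulLeft k a.unop)
    ext x; simp
  add_smul a b φ := by
    show φ.comp (LinearMap.mulLeft k ((a + b).unop)) =
      φ.comp (LinearMap.mulLeft k a.unop) + φ.comp (LinearMap.mulLeft k b.unop)
    ext x; simp [add_mul]
  zero_smul φ := by
    show φ.comp (LinearMap.mulLeft k ((0 : Aop k).unop)) = 0
    ext x; simp

/-- The right `A`-module `M = A ⊕ D(A)`, where `A` carries the right regular
`A`-module structure. -/
abbrev MA (k : Type) [Field k] : Type := AlgA k × DualA k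

/-- `X` belongs to `add M`: `X` is (isomorphic to) a direct summand of `Mⁿ` for some `n`. -/
def InAdd (k : Type) [Field k] (M X : Type) [AddCommGroup M] [Module (Aop k) M]
    [AddCommGroup X] [Module (Aop k) X] : Prop :=
  ∃ (n : ℕ) (ι : X →ₗ[Aop k] (Fin n → M)) (π : (Fin n → M) →ₗ[Aop k] X),
    π.comp ι = LinearMap.id

/-- `Ext^i_A(X, Y)` for right `A`-modules `X` and `Y`, computed in the abelian
category of all right `A`-modules (which has the same `Ext` groups as `mod A`). -/
noncomputable def ExtA (k : Type) [Field k] (X Y : Type) [AddCommGroup X] [Module (Aop k) X]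
    [AddCommGroup Y] [Module (Aop k) Y] (i : ℕ) : Type :=
  ((Ext ℤ (ModuleCat (Aop k)) i).obj (op (ModuleCat.of (Aop k) X))).obj (ModuleCat.of (Aop k) Y)

/-- The endomorphism algebra `B = End_A(A ⊕ D(A))`. -/
abbrev EndB (k : Type) [Field k] : Type := Module.End (Aop k) (MA k)

/-- Right `B`-modules are left modules over `Bᵐᵒᵖ`. -/
abbrev Bop (k : Type) [Field k] : Type := (EndB k)ᵐᵒᵖ

/-- `Ext^i_B(X, Y)` for right `B`-modules `X` and `Y`. -/
noncomputable def ExtB (k : Type) [Field k] (X Y : ModuleCat (Bop k)) (i : ℕ) : Type :=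
  ((Ext ℤ (ModuleCat (Bop k)) i).obj (op X)).obj Y

section

open Limits

universe v u

/-- The syzygy sequence `0 → coker d_{n+2} → P_n → coker d_{n+1} → 0` of a projective resolution. -/
noncomputable abbrev syzygyComplex {C : Type u} [Category.{v} C] [Abelian C] {X : C}
    (P : ProjectiveResolution X) (n : ℕ) : ShortComplex C :=
  ShortComplex.mk (P.complex.fromOpcycles (n + 1) n) (P.complex.pOpcycles n) (by
    rw [← cancel_epi (P.complex.pOpcycles (n + 1))]; simp)

theorem syzygyComplex_shortExact {C : Type u} [Category.{v} C] [Abelian C] {X : C}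
    (P : ProjectiveResolution X) (n : ℕ) : (syzygyComplex P n).ShortExact := by
  have hex : (syzygyComplex P n).Exact := by
    have h : (ShortComplex.mk _ _ (P.complex.d_pOpcycles (n + 1) n)).Exact :=
      ShortComplex.exact_of_g_is_cokernel _
        (P.complex.opcyclesIsCokernel (n + 1) n (by simp))
    let φ : ShortComplex.mk _ _ (P.complex.d_pOpcycles (n + 1) n) ⟶ syzygyComplex P n :=
      { τ₁ := P.complex.pOpcycles (n + 1), τ₂ := 𝟙 _, τ₃ := 𝟙 _ }
    have : Epi φ.τ₁ := inferInstanceAs (Epi (P.complex.pOpcycles (n + 1)))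
    have : IsIso φ.τ₂ := inferInstanceAs (IsIso (𝟙 _))
    have : Mono φ.τ₃ := inferInstanceAs (Mono (𝟙 _))
    exact (ShortComplex.exact_iff_of_epi_of_isIso_of_mono φ).1 h
  have hm : Mono (P.complex.fromOpcycles (n + 1) n) := by
    have h := P.complex_exactAt_succ n
    rw [HomologicalComplex.exactAt_iff' _ (n + 2) (n + 1) n (by simp) (by simp)] at h
    have := h.mono_fromOpcycles
    rw [← P.complex.opcyclesIsoSc'_inv_fromOpcycles (n + 2) (n + 1) n (by simp) (by simp)] at this
    exact (mono_comp_iff_of_isIso _ _).1 this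
  exact { exact := hex, mono_f := hm, epi_g := inferInstanceAs (Epi (P.complex.pOpcycles n)) }

theorem hasProjectiveDimensionLT_opcycles_iff {C : Type u} [Category.{v} C] [Abelian C] {X : C}
    (P : ProjectiveResolution X) (m n : ℕ) :
    HasProjectiveDimensionLT (P.complex.opcycles m) (n + 1) ↔
      HasProjectiveDimensionLT X (m + n + 1) := by
  induction m generalizing n with
  | zero =>
    have e : P.complex.opcycles 0 ≅ X :=
      (P.complex.opcyclesIsCokernel 1 0 (by simp)).coconePointUniqueUpToIso
        P.isColimitCokernelCofork
    rw [zero_add]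
    exact ⟨fun _ => hasProjectiveDimensionLT_of_iso e _,
      fun _ => hasProjectiveDimensionLT_of_iso e.symm _⟩
  | succ m ih =>
    rw [← (syzygyComplex_shortExact P m).hasProjectiveDimensionLT_X₃_iff n (P.projective m),
      show m + 1 + n + 1 = m + (n + 1) + 1 by omega, ← ih]

/-- `Ext^{n+1}(X, Y)`, computed by a projective resolution of `X`, vanishes if and only if every
`(n+1)`-cocycle with values in `Y` is a coboundary. -/
theorem subsingleton_ext_succ_iff {R : Type u} [Ring R] {X : ModuleCat.{u} R}
    (P : ProjectiveResolution X) (n : ℕ) (Y : ModuleCat.{u} R) :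
    Subsingleton (((Ext ℤ (ModuleCat.{u} R) (n + 1)).obj (op X)).obj Y) ↔
      ∀ f : P.complex.X (n + 1) ⟶ Y, P.complex.d (n + 2) (n + 1) ≫ f = 0 →
        ∃ g : P.complex.X n ⟶ Y, P.complex.d (n + 1) n ≫ g = f := by
  rw [← ModuleCat.isZero_iff_subsingleton, (P.isoExt (R := ℤ) (n + 1) Y).isZero_iff,
    ← HomologicalComplex.exactAt_iff_isZero_homology,
    HomologicalComplex.exactAt_iff' _ n (n + 1) (n + 2) (by simp) (by simp),
    ShortComplex.moduleCat_exact_iff]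
  rfl

/-- The derived functor `Ext^{n+1}(X, -)` vanishes if and only if `X` has projective
dimension at most `n`. -/
theorem hasProjectiveDimensionLT_succ_iff {R : Type u} [Ring R] (X : ModuleCat.{u} R) (n : ℕ) :
    HasProjectiveDimensionLT X (n + 1) ↔
      ∀ Y, Subsingleton (((Ext ℤ (ModuleCat.{u} R) (n + 1)).obj (op X)).obj Y) := by
  let P := projectiveResolution X
  have hS := syzygyComplex_shortExact P n
  simp only [subsingleton_ext_succ_iff P]
  refine (hasProjectiveDimensionLT_opcycles_iff P n 0).symm.trans
    (projective_iff_hasProjectiveDimensionLT_one.symm.trans ?_)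
  constructor
  · intro h Y f hf
    have s := hS.splittingOfProjective
    refine ⟨s.r ≫ P.complex.descOpcycles f (n + 2) (by simp) hf, ?_⟩
    rw [← P.complex.p_fromOpcycles, Category.assoc, s.f_r_assoc, P.complex.p_descOpcycles]
  · intro h
    obtain ⟨g, hg⟩ := h (P.complex.opcycles (n + 1)) (P.complex.pOpcycles (n + 1)) (by simp)
    have hr : P.complex.fromOpcycles (n + 1) n ≫ g = 𝟙 _ := by
      rw [← cancel_epi (P.complex.pOpcycles (n + 1)), P.complex.p_fromOpcycles_assoc, hg]
      simp
    have := hS.epi_g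
    let s := ShortComplex.Splitting.ofExactOfRetraction _ hS.exact g hr hS.epi_g
    exact Retract.projective (Y := P.complex.X n) ⟨s.s, P.complex.pOpcycles n, s.s_g⟩

theorem shortExact_of_function_exact {R : Type u} [Ring R] {K P N : Type u}
    [AddCommGroup K] [Module R K] [AddCommGroup P] [Module R P] [AddCommGroup N] [Module R N]
    (f : K →ₗ[R] P) (g : P →ₗ[R] N) (hf : Function.Injective f) (hfg : Function.Exact f g)
    (hg : Function.Surjective g) :
    (ShortComplex.mk (ModuleCat.ofHom f) (ModuleCat.ofHom g)
      (by ext x; exact hfg.apply_apply_eq_zero x)).ShortExact :=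
  ModuleCat.shortComplex_shortExact _ hfg hf hg

theorem kernel_shortExact {R : Type u} [Ring R] {P N : Type u}
    [AddCommGroup P] [Module R P] [AddCommGroup N] [Module R N]
    (g : P →ₗ[R] N) (hg : Function.Surjective g) :
    (ShortComplex.mk (ModuleCat.ofHom (LinearMap.ker g).subtype) (ModuleCat.ofHom g)
      (by ext x; exact x.2)).ShortExact :=
  shortExact_of_function_exact _ _ (Submodule.subtype_injective _)
    (LinearMap.exact_subtype_ker_map g) hg

theorem directSum_shortExact {R : Type u} [Ring R] {ι : Type u} {K P N : ι → Type u}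
    [∀ i, AddCommGroup (K i)] [∀ i, Module R (K i)] [∀ i, AddCommGroup (P i)]
    [∀ i, Module R (P i)] [∀ i, AddCommGroup (N i)] [∀ i, Module R (N i)]
    (f : ∀ i, K i →ₗ[R] P i) (g : ∀ i, P i →ₗ[R] N i) (hf : ∀ i, Function.Injective (f i))
    (hfg : ∀ i, Function.Exact (f i) (g i)) (hg : ∀ i, Function.Surjective (g i)) :
    (ShortComplex.mk (ModuleCat.ofHom (DirectSum.lmap f)) (ModuleCat.ofHom (DirectSum.lmap g))
      (by
        ext x i
        exact (hfg i).apply_apply_eq_zero _)).ShortExact := by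
  refine shortExact_of_function_exact _ _ ((DirectSum.lmap_injective _).2 hf) ?_
    ((DirectSum.lmap_surjective _).2 hg)
  classical
  rw [LinearMap.exact_iff, DirectSum.lmap, DirectSum.lmap, DFinsupp.ker_mapRangeLinearMap,
    DFinsupp.range_mapRangeLinearMap]
  simp only [(hfg _).linearMap_ker_eq]

/-- Direct sums of modules of projective dimension `< n` have projective dimension `< n`. -/
theorem hasProjectiveDimensionLT_directSum {R : Type u} [Ring R] (n : ℕ) {ι : Type u}
    (N : ι → Type u) [∀ i, AddCommGroup (N i)] [∀ i, Module R (N i)]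
    (h : ∀ i, HasProjectiveDimensionLT (ModuleCat.of R (N i)) n) :
    HasProjectiveDimensionLT (ModuleCat.of R (DirectSum ι N)) n := by
  classical
  match n with
  | 0 =>
    have : ∀ i, Subsingleton (N i) := fun i => by
      have := h i
      exact ModuleCat.subsingleton_of_isZero
        (isZero_of_hasProjectiveDimensionLT_zero (ModuleCat.of R (N i)))
    have : Subsingleton (DirectSum ι N) :=
      ⟨fun x y => DFinsupp.ext fun i => Subsingleton.elim _ _⟩
    exact (ModuleCat.isZero_of_subsingleton _).hasProjectiveDimensionLT_zero
  | 1 =>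
    have : ∀ i, Module.Projective R (N i) := fun i => by
      have := h i
      exact (IsProjective.iff_projective (N i)).2
        (projective_iff_hasProjectiveDimensionLT_one.2 inferInstance)
    have : Module.Projective R (DirectSum ι N) :=
      inferInstanceAs (Module.Projective R (Π₀ i, N i))
    have := (IsProjective.iff_projective (DirectSum ι N)).1 this
    infer_instance
  | n + 2 =>
    let g i : (N i →₀ R) →ₗ[R] N i := Finsupp.linearCombination R id
    have hg i : Function.Surjective (g i) := Finsupp.linearCombination_id_surjective R (N i)
    have hK i : HasProjectiveDimensionLT (ModuleCat.of R (LinearMap.ker (g i))) (n + 1) := by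
      have hP : Projective (ModuleCat.of R (N i →₀ R)) :=
        (IsProjective.iff_projective _).1 inferInstance
      exact ((kernel_shortExact (g i) (hg i)).hasProjectiveDimensionLT_X₃_iff n hP).1 (h i)
    have ih := hasProjectiveDimensionLT_directSum (n + 1) (fun i => LinearMap.ker (g i)) hK
    have hse := directSum_shortExact (K := fun i => LinearMap.ker (g i))
      (fun i => (LinearMap.ker (g i)).subtype) g
      (fun i => Subtype.val_injective) (fun i => LinearMap.exact_subtype_ker_map (g i)) hg
    have hP : Projective (ModuleCat.of R (DirectSum ι fun i => (N i →₀ R))) := by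
      have : Module.Projective R (DirectSum ι fun i => (N i →₀ R)) :=
        inferInstanceAs (Module.Projective R (Π₀ i, (N i →₀ R)))
      exact (IsProjective.iff_projective _).1 this
    exact (hse.hasProjectiveDimensionLT_X₃_iff n hP).2 ih

/-- If every element of `Rε` annihilated by `φ` lies in `Rψ`, then there is a short exact sequence
`0 → Rψ → Rε → Rφ → 0`. -/
theorem exists_shortExact_span_singleton {R : Type u} [Ring R] {ε φ ψ : R}
    (hε : ε * ε = ε) (hφ : ε * φ = φ) (hψ : ψ * ε = ψ) (hψφ : ψ * φ = 0)
    (hann : ∀ x, x * ε = x → x * φ = 0 → ∃ y, y * ψ = x) :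
    ∃ (f : ModuleCat.of R (Submodule.span R {ψ}) ⟶ ModuleCat.of R (Submodule.span R {ε}))
      (g : ModuleCat.of R (Submodule.span R {ε}) ⟶ ModuleCat.of R (Submodule.span R {φ}))
      (w : f ≫ g = 0), (ShortComplex.mk f g w).ShortExact := by
  have mem : ∀ x : R, x ∈ Submodule.span R {ε} ↔ x * ε = x := fun x => by
    rw [Submodule.mem_span_singleton]
    refine ⟨?_, fun h => ⟨x, h⟩⟩
    rintro ⟨y, rfl⟩
    rw [smul_eq_mul, mul_assoc, hε]
  have hle : Submodule.span R {ψ} ≤ Submodule.span R {ε} := by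
    rw [Submodule.span_singleton_le_iff_mem, mem, hψ]
  let g : Submodule.span R {ε} →ₗ[R] Submodule.span R {φ} :=
    ((LinearMap.toSpanSingleton R R φ).comp (Submodule.subtype _)).codRestrict _
      (fun x => Submodule.smul_mem _ _ (Submodule.mem_span_singleton_self φ))
  have hg : ∀ x, (g x : R) = x * φ := fun x => rfl
  refine ⟨_, _, _, shortExact_of_function_exact (Submodule.inclusion hle) g
    (Submodule.inclusion_injective hle) (fun x => ⟨fun hx => ?_, ?_⟩) fun ⟨y, hy⟩ => ?_⟩
  · obtain ⟨y, hy⟩ := hann x ((mem _).1 x.2) (congrArg Subtype.val hx)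
    exact ⟨⟨x, Submodule.mem_span_singleton.2 ⟨y, hy⟩⟩, rfl⟩
  · rintro ⟨⟨y, hy⟩, rfl⟩
    obtain ⟨z, rfl⟩ := Submodule.mem_span_singleton.1 hy
    apply Subtype.ext
    simp [hg, mul_assoc, hψφ]
  · obtain ⟨z, rfl⟩ := Submodule.mem_span_singleton.1 hy
    refine ⟨⟨z * ε, (mem _).2 (by rw [mul_assoc, hε])⟩, Subtype.ext ?_⟩
    simp [hg, mul_assoc, hφ]

theorem projective_span_singleton_of_idempotent {R : Type u} [Ring R] {ε : R} (hε : ε * ε = ε) :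
    Projective (ModuleCat.of R (Submodule.span R {ε})) := by
  refine (IsProjective.iff_projective _).1 (Module.Projective.of_split (M := R)
    (Submodule.subtype _)
    (LinearMap.toSpanSingleton R _ ⟨ε, Submodule.mem_span_singleton_self ε⟩) ?_)
  ext ⟨x, hx⟩
  obtain ⟨z, rfl⟩ := Submodule.mem_span_singleton.1 hx
  simp [mul_assoc, hε]

theorem hasProjectiveDimensionLT_span_singleton {R : Type u} [Ring R] {ε φ ψ : R} (n : ℕ)
    (hε : ε * ε = ε) (hφ : ε * φ = φ) (hψ : ψ * ε = ψ) (hψφ : ψ * φ = 0)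
    (hann : ∀ x, x * ε = x → x * φ = 0 → ∃ y, y * ψ = x)
    (h : HasProjectiveDimensionLT (ModuleCat.of R (Submodule.span R {ψ})) n) :
    HasProjectiveDimensionLT (ModuleCat.of R (Submodule.span R {φ})) (n + 1) := by
  obtain ⟨f, g, w, hse⟩ := exists_shortExact_span_singleton hε hφ hψ hψφ hann
  have := projective_span_singleton_of_idempotent hε
  exact hse.hasProjectiveDimensionLT_X₃ n h
    (hasProjectiveDimensionLT_of_ge _ 1 (n + 1) (by omega))

theorem hasProjectiveDimensionLT_span_singleton_syzygy {R : Type u} [Ring R] {ε φ ψ : R} (n : ℕ)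
    (hε : ε * ε = ε) (hφ : ε * φ = φ) (hψ : ψ * ε = ψ) (hψφ : ψ * φ = 0)
    (hann : ∀ x, x * ε = x → x * φ = 0 → ∃ y, y * ψ = x)
    (h : HasProjectiveDimensionLT (ModuleCat.of R (Submodule.span R {φ})) (n + 2)) :
    HasProjectiveDimensionLT (ModuleCat.of R (Submodule.span R {ψ})) (n + 1) := by
  obtain ⟨f, g, w, hse⟩ := exists_shortExact_span_singleton hε hφ hψ hψφ hann
  exact (hse.hasProjectiveDimensionLT_X₃_iff n (projective_span_singleton_of_idempotent hε)).1 h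

theorem hasProjectiveDimensionLT_of_quotient {R : Type u} [Ring R] (I : Ideal R) (n : ℕ)
    (h : HasProjectiveDimensionLT (ModuleCat.of R (R ⧸ I)) (n + 2)) :
    HasProjectiveDimensionLT (ModuleCat.of R I) (n + 1) :=
  ((shortExact_of_function_exact (Submodule.subtype I) (Submodule.mkQ I)
    (Submodule.subtype_injective _) (LinearMap.exact_subtype_mkQ I)
    (Submodule.mkQ_surjective I)).hasProjectiveDimensionLT_X₃_iff n
      ((IsProjective.iff_projective R).1 inferInstance)).1 h

/-- If `Rφ` is projective, then the annihilator of `φ` is also the annihilator of an element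
fixing `φ`. -/
theorem exists_mul_eq_of_projective_span_singleton {R : Type u} [Ring R] {φ : R}
    (h : HasProjectiveDimensionLT (ModuleCat.of R (Submodule.span R {φ})) 1) :
    ∃ q, q * φ = φ ∧ ∀ a, a * φ = 0 → a * q = 0 := by
  have : Module.Projective R (Submodule.span R {φ}) := (IsProjective.iff_projective _).2
    (projective_iff_hasProjectiveDimensionLT_one.2 h)
  let e : Submodule.span R {φ} := ⟨φ, Submodule.mem_span_singleton_self φ⟩
  obtain ⟨s, hs⟩ := Module.projective_lifting_property (LinearMap.toSpanSingleton R _ e)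
    LinearMap.id fun ⟨y, hy⟩ => by
      obtain ⟨z, rfl⟩ := Submodule.mem_span_singleton.1 hy
      exact ⟨z, rfl⟩
  refine ⟨s e, congrArg Subtype.val (LinearMap.congr_fun hs e), fun a ha => ?_⟩
  have hae : a • e = 0 := Subtype.ext ha
  rw [← smul_eq_mul, ← map_smul, hae, map_zero]

/-- If `R ⧸ I` is semisimple and `I` has projective dimension `< n` as a left ideal, then every
`R`-module killed by `I` has projective dimension `< n + 1`. -/
theorem hasProjectiveDimensionLT_of_isTorsionBySet {R : Type u} [Ring R] (I : Ideal R)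
    [I.IsTwoSided] [IsSemisimpleRing (R ⧸ I)] (n : ℕ)
    (hI : HasProjectiveDimensionLT (ModuleCat.of R I) n)
    {N : Type u} [AddCommGroup N] [Module R N] (hN : Module.IsTorsionBySet R N I) :
    HasProjectiveDimensionLT (ModuleCat.of R N) (n + 1) := by
  classical
  have hQ : HasProjectiveDimensionLT (ModuleCat.of R (R ⧸ I)) (n + 1) := by
    have hse := shortExact_of_function_exact (Submodule.subtype I) (Submodule.mkQ I)
      (Submodule.subtype_injective _) (LinearMap.exact_subtype_mkQ I) (Submodule.mkQ_surjective I)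
    have : Projective (ModuleCat.of R R) := (IsProjective.iff_projective _).1 inferInstance
    exact hse.hasProjectiveDimensionLT_X₃ n hI
      (hasProjectiveDimensionLT_of_ge _ 1 (n + 1) (by omega))
  have hF : HasProjectiveDimensionLT (ModuleCat.of R (N →₀ R ⧸ I)) (n + 1) := by
    have := hasProjectiveDimensionLT_directSum (n + 1) (fun _ : N => R ⧸ I) (fun _ => hQ)
    exact hasProjectiveDimensionLT_of_iso
      (finsuppLEquivDirectSum R (R ⧸ I) N).symm.toModuleIso (n + 1)
  let := hN.module
  have : IsScalarTower R (R ⧸ I) N := hN.isScalarTower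
  have := Module.projective_of_isSemisimpleRing (R ⧸ I) N
  obtain ⟨s, hs⟩ := Module.projective_lifting_property
    (Finsupp.linearCombination (R ⧸ I) (id : N → N)) LinearMap.id
    (Finsupp.linearCombination_id_surjective _ N)
  have hr : Retract (ModuleCat.of R N) (ModuleCat.of R (N →₀ R ⧸ I)) :=
    { i := ModuleCat.ofHom (s.restrictScalars R)
      r := ModuleCat.ofHom ((Finsupp.linearCombination (R ⧸ I) (id : N → N)).restrictScalars R)
      retract := by ext x; exact LinearMap.congr_fun hs x }
  exact hr.hasProjectiveDimensionLT (n + 1)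

/-- The submodule of elements that the two-sided ideal `I` moves into `L`. -/
def idealTransporter {R : Type u} [Ring R] (I : Ideal R) [I.IsTwoSided] {N : Type u}
    [AddCommGroup N] [Module R N] (L : Submodule R N) : Submodule R N where
  carrier := {x | ∀ r ∈ I, r • x ∈ L}
  add_mem' hx hy r hr := by rw [smul_add]; exact L.add_mem (hx r hr) (hy r hr)
  zero_mem' r _ := by rw [smul_zero]; exact L.zero_mem
  smul_mem' c x hx r hr := by
    rw [← mul_smul]; exact hx _ (I.mul_mem_right c hr)

theorem hasProjectiveDimensionLT_idealTransporter {R : Type u} [Ring R] (I : Ideal R)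
    [I.IsTwoSided] [IsSemisimpleRing (R ⧸ I)] (n : ℕ)
    (hI : HasProjectiveDimensionLT (ModuleCat.of R I) n)
    {N : Type u} [AddCommGroup N] [Module R N] (L : Submodule R N)
    (hL : HasProjectiveDimensionLT (ModuleCat.of R L) (n + 1)) :
    HasProjectiveDimensionLT (ModuleCat.of R (idealTransporter I L)) (n + 1) := by
  have hle : L ≤ idealTransporter I L := fun x hx r _ => L.smul_mem r hx
  let L' : Submodule R (idealTransporter I L) := L.comap (Submodule.subtype _)
  have hL' : HasProjectiveDimensionLT (ModuleCat.of R L') (n + 1) :=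
    hasProjectiveDimensionLT_of_iso (Submodule.comapSubtypeEquivOfLe hle).symm.toModuleIso _
  have hQ : HasProjectiveDimensionLT (ModuleCat.of R (idealTransporter I L ⧸ L')) (n + 1) := by
    refine hasProjectiveDimensionLT_of_isTorsionBySet I n hI ?_
    rintro x ⟨r, hr⟩
    obtain ⟨x, rfl⟩ := Submodule.Quotient.mk_surjective _ x
    exact (Submodule.Quotient.mk_eq_zero _).2 (x.2 r hr)
  exact (shortExact_of_function_exact L'.subtype L'.mkQ (Submodule.subtype_injective _)
    (LinearMap.exact_subtype_mkQ L') (Submodule.mkQ_surjective L')).hasProjectiveDimensionLT_X₂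
      (n + 1) hL' hQ

/-- If `R ⧸ I` is semisimple, `I⁴ = 0` and `I` has projective dimension `< n` as a left ideal,
then every `R`-module has projective dimension `< n + 1`. -/
theorem hasProjectiveDimensionLT_of_nilpotent {R : Type u} [Ring R] (I : Ideal R)
    [I.IsTwoSided] [IsSemisimpleRing (R ⧸ I)] (n : ℕ)
    (hI : HasProjectiveDimensionLT (ModuleCat.of R I) n)
    (hnil : ∀ a ∈ I, ∀ b ∈ I, ∀ c ∈ I, ∀ d ∈ I, a * b * c * d = 0)
    (N : ModuleCat.{u} R) : HasProjectiveDimensionLT N (n + 1) := by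
  have step := fun L : Submodule R N => hasProjectiveDimensionLT_idealTransporter I n hI L
  have h0 : HasProjectiveDimensionLT (ModuleCat.of R (⊥ : Submodule R N)) (n + 1) := by
    have := (ModuleCat.isZero_of_subsingleton
      (ModuleCat.of R (⊥ : Submodule R N))).hasProjectiveDimensionLT_zero
    exact hasProjectiveDimensionLT_of_ge _ 0 (n + 1) (by omega)
  have h4 := step _ (step _ (step _ (step _ h0)))
  have htop : idealTransporter I (idealTransporter I (idealTransporter I
      (idealTransporter I (⊥ : Submodule R N)))) = ⊤ := by
    rw [eq_top_iff]
    intro x _ d hd c hc b hb a ha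
    rw [← mul_smul, ← mul_smul, ← mul_smul, Submodule.mem_bot, hnil a ha b hb c hc d hd, zero_smul]
  rw [htop] at h4
  exact hasProjectiveDimensionLT_of_iso (Submodule.topEquiv (R := R) (M := N)).toModuleIso _

/-- A left ideal that is the direct sum of finitely many principal left ideals of projective
dimension `< n` has projective dimension `< n`. -/
theorem hasProjectiveDimensionLT_of_principal_decomposition {R : Type u} [Ring R] (I : Ideal R)
    (n : ℕ) {m : ℕ} (φ : Fin m → R) (hmem : ∀ i, φ i ∈ I)
    (hspan : ∀ x ∈ I, ∃ y : Fin m → R, ∑ i, y i * φ i = x)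
    (hind : ∀ y : Fin m → R, ∑ i, y i * φ i = 0 → ∀ i, y i * φ i = 0)
    (h : ∀ i, HasProjectiveDimensionLT (ModuleCat.of R (Submodule.span R {φ i})) n) :
    HasProjectiveDimensionLT (ModuleCat.of R I) n := by
  classical
  let P : ULift.{u} (Fin m) → Submodule R R := fun i => Submodule.span R {φ i.down}
  have hP : ∀ i, P i ≤ I := fun i => by
    rw [Submodule.span_singleton_le_iff_mem]; exact hmem _
  let f : DirectSum _ (fun i => P i) →ₗ[R] I :=
    DirectSum.toModule R _ _ fun i => Submodule.inclusion (hP i)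
  have hf : ∀ x, (f x : R) = ∑ i, (x ⟨i⟩ : R) := fun x => by
    induction x using DirectSum.induction_on with
    | zero => simp
    | of i x =>
      rw [← DirectSum.lof_eq_of R, DirectSum.toModule_lof, Finset.sum_eq_single i.down]
      · simp [DirectSum.lof_apply]
      · intro j _ hj
        rw [DirectSum.lof_eq_of, DirectSum.of_eq_of_ne]
        · rfl
        · rintro rfl; exact hj rfl
      · simp
    | add x y hx hy => simp [hx, hy, Finset.sum_add_distrib]
  have hbij : Function.Bijective f := by
    constructor
    · rw [injective_iff_map_eq_zero]
      intro x hx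
      have hx' := congrArg Subtype.val hx
      rw [hf] at hx'
      choose y hy using fun i => Submodule.mem_span_singleton.1 (x ⟨i⟩).2
      ext i
      have := hind y (by simpa only [← smul_eq_mul, hy, ZeroMemClass.coe_zero] using hx') i.down
      rw [← smul_eq_mul, hy] at this
      simpa using this
    · rintro ⟨x, hx⟩
      obtain ⟨y, rfl⟩ := hspan x hx
      refine ⟨DFinsupp.equivFunOnFintype.symm fun i =>
        ⟨y i.down * φ i.down, Submodule.mem_span_singleton.2 ⟨_, rfl⟩⟩, Subtype.ext ?_⟩
      rw [hf]
      rfl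
  have := hasProjectiveDimensionLT_directSum (R := R) n (fun i => P i) (fun i => h i.down)
  exact hasProjectiveDimensionLT_of_iso (LinearEquiv.ofBijective f hbij).toModuleIso n

end

/-- The vertex idempotents of `A`. -/
noncomputable def vtx (k : Type) [Field k] (i : Fin 3) : AlgA k :=
  RingQuot.mkAlgHom k (ARel k) (FreeAlgebra.ι k (QGen.e i))

/-- The arrows of `A`. -/
noncomputable def arw (k : Type) [Field k] (a : Fin 4) : AlgA k :=
  RingQuot.mkAlgHom k (ARel k) (FreeAlgebra.ι k (QGen.ar a))

section

variable {k : Type} [Field k]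

theorem vtx_mul_vtx (i j : Fin 3) : vtx k i * vtx k j = if i = j then vtx k i else 0 := by
  have := RingQuot.mkAlgHom_rel k (ARel.idem (k := k) i j)
  rw [map_mul] at this
  rw [vtx, vtx, this]
  split_ifs <;> simp

theorem sum_vtx : vtx k 0 + vtx k 1 + vtx k 2 = 1 := by
  simpa [vtx] using RingQuot.mkAlgHom_rel k (ARel.sum (k := k))

theorem arw_mul_arw (a b : Fin 4) : arw k a * arw k b = 0 := by
  simpa [arw] using RingQuot.mkAlgHom_rel k (ARel.radsq (k := k) a b)

theorem vtx_mul_arw (i : Fin 3) (a : Fin 4) :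
    vtx k i * arw k a = if i = arrowSrc a then arw k a else 0 := by
  have h : vtx k (arrowSrc a) * arw k a = arw k a := by
    simpa [vtx, arw] using RingQuot.mkAlgHom_rel k (ARel.src (k := k) a)
  rw [← h, ← mul_assoc, vtx_mul_vtx]
  split_ifs with hi <;> simp [hi]

theorem arw_mul_vtx (a : Fin 4) (i : Fin 3) :
    arw k a * vtx k i = if arrowTgt a = i then arw k a else 0 := by
  have h : arw k a * vtx k (arrowTgt a) = arw k a := by
    simpa [vtx, arw] using RingQuot.mkAlgHom_rel k (ARel.tgt (k := k) a)
  rw [← h, mul_assoc, vtx_mul_vtx]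
  split_ifs with hi <;> simp

theorem AlgA.induction {P : AlgA k → Prop} (one : P 1) (smul : ∀ (c : k) a, P a → P (c • a))
    (hvtx : ∀ i, P (vtx k i)) (harw : ∀ a, P (arw k a)) (add : ∀ a b, P a → P b → P (a + b))
    (mul : ∀ a b, P a → P b → P (a * b)) (a : AlgA k) : P a := by
  obtain ⟨w, rfl⟩ := RingQuot.mkAlgHom_surjective k (ARel k) a
  induction w using FreeAlgebra.induction with
  | grade0 r => rw [AlgHom.commutes, Algebra.algebraMap_eq_smul_one]; exact smul _ _ one
  | grade1 g =>
    cases g with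
    | e i => exact hvtx i
    | ar a => exact harw a
  | mul a b ha hb => rw [map_mul]; exact mul _ _ ha hb
  | add a b ha hb => rw [map_add]; exact add _ _ ha hb

/-- The representation of `A` by upper triangular matrices attached to an arrow. -/
noncomputable def arrowRep (k : Type) [Field k] (a : Fin 4) :
    AlgA k →ₐ[k] Matrix (Fin 2) (Fin 2) k :=
  RingQuot.liftAlgHom k
    ⟨FreeAlgebra.lift k (fun g => match g with
        | QGen.e j => !![if j = arrowSrc a then 1 else 0, 0; 0, if j = arrowTgt a then 1 else 0]
        | QGen.ar b => !![0, if b = a then 1 else 0; 0, 0]), by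
      intro _x _y h
      have hne : ∀ a, arrowSrc a ≠ arrowTgt a := by decide
      have hinj : ∀ a b, arrowSrc a = arrowSrc b → arrowTgt a = arrowTgt b → a = b := by decide
      have hz : !![(0 : k), 0; 0, 0] = 0 := (Matrix.eta_fin_two 0).symm
      induction h with
      | idem i j =>
          simp only [map_mul, FreeAlgebra.lift_ι_apply, apply_ite, map_zero, Matrix.mul_fin_two]
          split_ifs <;> simp_all
      | sum =>
          simp only [map_add, map_one, FreeAlgebra.lift_ι_apply, Matrix.one_fin_two]
          fin_cases a <;> simp [arrowSrc, arrowTgt]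
      | src b =>
          simp only [map_mul, FreeAlgebra.lift_ι_apply, Matrix.mul_fin_two]
          split_ifs <;> simp_all
      | tgt b =>
          simp only [map_mul, FreeAlgebra.lift_ι_apply, Matrix.mul_fin_two]
          split_ifs <;> simp_all
      | radsq b c =>
          simp only [map_mul, FreeAlgebra.lift_ι_apply, Matrix.mul_fin_two]
          simp [hz]⟩

/-- The dual basis elements of `D(A)` attached to the vertices. -/
noncomputable def vtxDual (k : Type) [Field k] (i : Fin 3) : DualA k :=
  (simpleAlgHom k i).toLinearMap

/-- The dual basis elements of `D(A)` attached to the arrows. -/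
noncomputable def arwDual (k : Type) [Field k] (a : Fin 4) : DualA k :=
  Matrix.entryLinearMap k k 0 1 ∘ₗ (arrowRep k a).toLinearMap

theorem vtxDual_vtx (i j : Fin 3) : vtxDual k i (vtx k j) = if j = i then 1 else 0 := by
  simp [vtxDual, vtx, simpleAlgHom]

theorem vtxDual_arw (i : Fin 3) (a : Fin 4) : vtxDual k i (arw k a) = 0 := by
  simp [vtxDual, arw, simpleAlgHom]

theorem arrowRep_vtx (a : Fin 4) (j : Fin 3) : arrowRep k a (vtx k j) =
    !![if j = arrowSrc a then 1 else 0, 0; 0, if j = arrowTgt a then 1 else 0] := by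
  simp [vtx, arrowRep]

theorem arrowRep_arw (a b : Fin 4) : arrowRep k a (arw k b) =
    !![0, if b = a then 1 else 0; 0, 0] := by
  simp [arw, arrowRep]

theorem arwDual_vtx (a : Fin 4) (i : Fin 3) : arwDual k a (vtx k i) = 0 := by
  simp [arwDual, arrowRep_vtx]

theorem arwDual_arw (a b : Fin 4) : arwDual k a (arw k b) = if b = a then 1 else 0 := by
  simp [arwDual, arrowRep_arw]

theorem vtxDual_mul (i : Fin 3) (x y : AlgA k) :
    vtxDual k i (x * y) = vtxDual k i x * vtxDual k i y := by
  simp [vtxDual]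

theorem arrowRep_eq (a : Fin 4) (x : AlgA k) : arrowRep k a x =
    !![vtxDual k (arrowSrc a) x, arwDual k a x; 0, vtxDual k (arrowTgt a) x] := by
  induction x using AlgA.induction with
  | one => simp [vtxDual, arwDual, Matrix.one_fin_two]
  | smul c x hx => rw [map_smul, hx]; simp
  | hvtx i => simp only [arrowRep_vtx, vtxDual_vtx, arwDual_vtx]
  | harw b => simp only [arrowRep_arw, vtxDual_arw, arwDual_arw]
  | add x y hx hy => rw [map_add, hx, hy]; simp
  | mul x y hx hy =>
    have : arwDual k a (x * y) = (arrowRep k a (x * y)) 0 1 := rfl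
    rw [this, map_mul, hx, hy, Matrix.mul_fin_two]
    simp [vtxDual_mul]

theorem arwDual_mul (a : Fin 4) (x y : AlgA k) : arwDual k a (x * y) =
    vtxDual k (arrowSrc a) x * arwDual k a y + arwDual k a x * vtxDual k (arrowTgt a) y := by
  have : arwDual k a (x * y) = (arrowRep k a (x * y)) 0 1 := rfl
  rw [this, map_mul, arrowRep_eq, arrowRep_eq, Matrix.mul_fin_two]
  rfl

theorem eq_sum_basis (x : AlgA k) :
    x = ∑ i, vtxDual k i x • vtx k i + ∑ a, arwDual k a x • arw k a := by
  induction x using AlgA.induction with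
  | one =>
    have h1 : ∀ i, vtxDual k i 1 = 1 := fun i => by simp [vtxDual]
    have h2 : ∀ i, arwDual k i 1 = 0 := fun i => by simp [arwDual]
    simp [h1, h2, Fin.sum_univ_three, sum_vtx]
  | smul c x hx => 
    conv_lhs => rw [hx]
    simp [Finset.smul_sum, mul_smul]
  | hvtx i => simp [vtxDual_vtx, arwDual_vtx]
  | harw b => simp [vtxDual_arw, arwDual_arw]
  | add x y hx hy => 
    conv_lhs => rw [hx, hy]
    simp [add_smul, Finset.sum_add_distrib]; abel
  | mul x y hx hy => 
    conv_lhs => rw [hx, hy]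
    simp only [vtxDual_mul, arwDual_mul, Fin.sum_univ_three, Fin.sum_univ_four, add_mul, mul_add,
      smul_mul_smul_comm, vtx_mul_vtx, vtx_mul_arw, arw_mul_vtx, arw_mul_arw, arrowSrc, arrowTgt]
    simp
    module

end

/-- Coordinates of an endomorphism of `A ⊕ D(A)` in a basis adapted to the indecomposable
summands. The names `p`, `u`, `c` belong to maps `A → A`, the names `v`, `d`, `a`, `b` to maps
`A → D(A)`, the names `q`, `s`, `h` to maps `D(A) → D(A)` and the names `r`, `g` to maps
`D(A) → A`. -/
@[ext]
structure EndCoord (k : Type) where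
  (p₁ p₂ p₃ u₁ u₃ c₁ c₃ : k)
  (v₁ v₃ d a₁ a₃ b₁ b₃ : k)
  (q₁ q₂ q₃ s₁ s₃ h₁ h₃ : k)
  (r₁ r₃ g₁₁ g₁₃ g₃₁ g₃₃ : k)

namespace EndCoord

variable {k : Type} [Field k]

/-- Coordinatewise addition. -/
@[simps]
protected def add (x y : EndCoord k) : EndCoord k where
  p₁ := x.p₁ + y.p₁
  p₂ := x.p₂ + y.p₂
  p₃ := x.p₃ + y.p₃
  u₁ := x.u₁ + y.u₁
  u₃ := x.u₃ + y.u₃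
  c₁ := x.c₁ + y.c₁
  c₃ := x.c₃ + y.c₃
  v₁ := x.v₁ + y.v₁
  v₃ := x.v₃ + y.v₃
  d := x.d + y.d
  a₁ := x.a₁ + y.a₁
  a₃ := x.a₃ + y.a₃
  b₁ := x.b₁ + y.b₁
  b₃ := x.b₃ + y.b₃
  q₁ := x.q₁ + y.q₁
  q₂ := x.q₂ + y.q₂
  q₃ := x.q₃ + y.q₃
  s₁ := x.s₁ + y.s₁
  s₃ := x.s₃ + y.s₃
  h₁ := x.h₁ + y.h₁
  h₃ := x.h₃ + y.h₃
  r₁ := x.r₁ + y.r₁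
  r₃ := x.r₃ + y.r₃
  g₁₁ := x.g₁₁ + y.g₁₁
  g₁₃ := x.g₁₃ + y.g₁₃
  g₃₁ := x.g₃₁ + y.g₃₁
  g₃₃ := x.g₃₃ + y.g₃₃

instance : Add (EndCoord k) := ⟨EndCoord.add⟩

/-- The coordinates of a composition. -/
@[simps]
protected def mul (x y : EndCoord k) : EndCoord k where
  p₁ := x.p₁ * y.p₁
  p₂ := x.p₂ * y.p₂
  p₃ := x.p₃ * y.p₃
  u₁ := x.p₂ * y.u₁ + x.u₁ * y.p₁ + x.r₁ * y.a₁
  u₃ := x.p₂ * y.u₃ + x.u₃ * y.p₃ + x.r₃ * y.a₃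
  c₁ := x.p₁ * y.c₁ + x.c₁ * y.p₂ + x.g₁₁ * y.b₁ + x.g₃₁ * y.b₃
  c₃ := x.p₃ * y.c₃ + x.c₃ * y.p₂ + x.g₁₃ * y.b₁ + x.g₃₃ * y.b₃
  v₁ := x.v₁ * y.p₁ + x.b₁ * y.u₁ + x.q₁ * y.v₁ + x.s₁ * y.a₁
  v₃ := x.v₃ * y.p₃ + x.b₃ * y.u₃ + x.q₃ * y.v₃ + x.s₃ * y.a₃
  d := x.d * y.p₂ + x.a₁ * y.c₁ + x.a₃ * y.c₃ + x.q₂ * y.d + x.h₁ * y.b₁ + x.h₃ * y.b₃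
  a₁ := x.a₁ * y.p₁ + x.q₂ * y.a₁
  a₃ := x.a₃ * y.p₃ + x.q₂ * y.a₃
  b₁ := x.b₁ * y.p₂ + x.q₁ * y.b₁
  b₃ := x.b₃ * y.p₂ + x.q₃ * y.b₃
  q₁ := x.q₁ * y.q₁
  q₂ := x.q₂ * y.q₂
  q₃ := x.q₃ * y.q₃
  s₁ := x.q₁ * y.s₁ + x.s₁ * y.q₂ + x.b₁ * y.r₁
  s₃ := x.q₃ * y.s₃ + x.s₃ * y.q₂ + x.b₃ * y.r₃
  h₁ := x.q₂ * y.h₁ + x.h₁ * y.q₁ + x.a₁ * y.g₁₁ + x.a₃ * y.g₁₃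
  h₃ := x.q₂ * y.h₃ + x.h₃ * y.q₃ + x.a₁ * y.g₃₁ + x.a₃ * y.g₃₃
  r₁ := x.p₂ * y.r₁ + x.r₁ * y.q₂
  r₃ := x.p₂ * y.r₃ + x.r₃ * y.q₂
  g₁₁ := x.p₁ * y.g₁₁ + x.g₁₁ * y.q₁
  g₁₃ := x.p₃ * y.g₁₃ + x.g₁₃ * y.q₁
  g₃₁ := x.p₁ * y.g₃₁ + x.g₃₁ * y.q₃
  g₃₃ := x.p₃ * y.g₃₃ + x.g₃₃ * y.q₃

instance : Mul (EndCoord k) := ⟨EndCoord.mul⟩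

theorem add_def (x y : EndCoord k) : x + y = x.add y := rfl

theorem mul_def (x y : EndCoord k) : x * y = x.mul y := rfl

end EndCoord

section

variable {k : Type} [Field k]

theorem AlgA.ext {x y : AlgA k} (hv : ∀ i, vtxDual k i x = vtxDual k i y)
    (ha : ∀ a, arwDual k a x = arwDual k a y) : x = y := by
  rw [eq_sum_basis x, eq_sum_basis y]
  simp only [hv, ha]

theorem DualA.ext {φ ψ : DualA k} (hv : ∀ i, φ (vtx k i) = ψ (vtx k i))
    (ha : ∀ a, φ (arw k a) = ψ (arw k a)) : φ = ψ := by
  ext x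
  rw [eq_sum_basis x]
  simp only [map_add, map_sum, map_smul, hv, ha]

theorem DualA.op_smul_apply (x : Aop k) (φ : DualA k) (y : AlgA k) :
    (x • φ) y = φ (x.unop * y) := rfl

theorem mul_arw (x : AlgA k) (a : Fin 4) :
    x * arw k a = vtxDual k (arrowSrc a) x • arw k a := by
  conv_lhs => rw [eq_sum_basis x]
  simp [add_mul, Finset.sum_mul, vtx_mul_arw, arw_mul_arw]

theorem arw_mul (a : Fin 4) (x : AlgA k) :
    arw k a * x = vtxDual k (arrowTgt a) x • arw k a := by
  conv_lhs => rw [eq_sum_basis x]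
  simp [mul_add, Finset.mul_sum, arw_mul_vtx, arw_mul_arw]

namespace EndCoord

/-- The component `A → A` as left multiplication by an element. -/
noncomputable def homAA (x : EndCoord k) : AlgA k :=
  x.p₁ • vtx k 0 + x.p₂ • vtx k 1 + x.p₃ • vtx k 2 +
    (x.c₁ • arw k 0 + x.u₁ • arw k 1 + x.u₃ • arw k 2 + x.c₃ • arw k 3)

/-- The component `A → D(A)` as the image of `1`. -/
noncomputable def homAD (x : EndCoord k) : DualA k :=
  x.v₁ • vtxDual k 0 + x.d • vtxDual k 1 + x.v₃ • vtxDual k 2 +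
    (x.a₁ • arwDual k 0 + x.b₁ • arwDual k 1 + x.b₃ • arwDual k 2 + x.a₃ • arwDual k 3)

/-- The component `D(A) → D(A)` as left multiplication by an element. -/
noncomputable def homDD (x : EndCoord k) : AlgA k :=
  x.q₁ • vtx k 0 + x.q₂ • vtx k 1 + x.q₃ • vtx k 2 +
    (x.s₁ • arw k 0 + x.h₁ • arw k 1 + x.h₃ • arw k 2 + x.s₃ • arw k 3)

/-- The component `D(A) → A`. -/
noncomputable def homDA (x : EndCoord k) : DualA k →ₗ[k] AlgA k where
  toFun φ := (x.g₁₁ * φ (arw k 1) + x.g₃₁ * φ (arw k 2)) • arw k 0 +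
    (x.r₁ * φ (arw k 0)) • arw k 1 + (x.r₃ * φ (arw k 3)) • arw k 2 +
    (x.g₁₃ * φ (arw k 1) + x.g₃₃ * φ (arw k 2)) • arw k 3
  map_add' φ ψ := by simp only [LinearMap.add_apply]; module
  map_smul' c φ := by simp only [LinearMap.smul_apply, smul_eq_mul, RingHom.id_apply]; module

theorem homDA_apply (x : EndCoord k) (φ : DualA k) :
    x.homDA φ = (x.g₁₁ * φ (arw k 1) + x.g₃₁ * φ (arw k 2)) • arw k 0 +
      (x.r₁ * φ (arw k 0)) • arw k 1 + (x.r₃ * φ (arw k 3)) • arw k 2 +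
      (x.g₁₃ * φ (arw k 1) + x.g₃₃ * φ (arw k 2)) • arw k 3 := rfl

theorem homDA_op_smul (x : EndCoord k) (y : Aop k) (φ : DualA k) :
    x.homDA (y • φ) = x.homDA φ * y.unop := by
  simp only [homDA_apply, DualA.op_smul_apply, mul_arw, add_mul, smul_mul_assoc, arw_mul, map_smul,
    arrowSrc, arrowTgt]
  simp
  module

/-- The endomorphism with given coordinates. -/
noncomputable def toEnd (x : EndCoord k) : EndB k where
  toFun m := (x.homAA * m.1 + x.homDA m.2,
    MulOpposite.op m.1 • x.homAD + m.2 ∘ₗ LinearMap.mulRight k x.homDD)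
  map_add' m n := by
    refine Prod.ext ?_ ?_
    · simp [mul_add]; abel
    · simp [add_smul, LinearMap.add_comp]; abel
  map_smul' y m := by
    refine Prod.ext ?_ ?_
    · simp [homDA_op_smul, mul_assoc]
    · ext z
      simp [DualA.op_smul_apply, mul_assoc]

theorem toEnd_apply (x : EndCoord k) (m : MA k) :
    x.toEnd m = (x.homAA * m.1 + x.homDA m.2,
      MulOpposite.op m.1 • x.homAD + m.2 ∘ₗ LinearMap.mulRight k x.homDD) := rfl

theorem homAA_mul (x y : EndCoord k) :
    (x * y).homAA = x.homAA * y.homAA + x.homDA y.homAD := by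
  simp only [homDA_apply]
  simp only [homAA, homAD, add_mul, mul_add, smul_mul_smul_comm, vtx_mul_vtx, vtx_mul_arw,
    arw_mul_vtx, arw_mul_arw, arrowSrc, arrowTgt, LinearMap.add_apply, LinearMap.smul_apply,
    arwDual_arw, vtxDual_arw, mul_def]
  simp
  module

theorem homDA_mul (x y : EndCoord k) (φ : DualA k) : (x * y).homDA φ =
    x.homAA * y.homDA φ + x.homDA (φ ∘ₗ LinearMap.mulRight k y.homDD) := by
  simp only [homDA_apply, LinearMap.comp_apply, LinearMap.mulRight_apply, arw_mul, map_smul,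
    mul_add, mul_smul_comm, mul_arw]
  simp [homAA, homDD, vtxDual_arw, vtxDual_vtx, arrowSrc, arrowTgt, mul_def]
  module

theorem homAD_mul (x y : EndCoord k) : (x * y).homAD =
    MulOpposite.op y.homAA • x.homAD + y.homAD ∘ₗ LinearMap.mulRight k x.homDD := by
  refine DualA.ext (fun i => ?_) fun i => ?_
  · simp only [LinearMap.add_apply, DualA.op_smul_apply, LinearMap.comp_apply, MulOpposite.unop_op,
      LinearMap.mulRight_apply, homAA, homDD, add_mul, mul_add, smul_mul_assoc, mul_smul_comm,
      vtx_mul_vtx, vtx_mul_arw, arw_mul_vtx, homAD, mul_def, LinearMap.smul_apply, map_add,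
      map_smul, vtxDual_vtx, arwDual_vtx]
    fin_cases i <;>
      simp [arrowSrc, arrowTgt, vtxDual_vtx, vtxDual_arw, arwDual_vtx, arwDual_arw] <;> ring
  · simp only [LinearMap.add_apply, DualA.op_smul_apply, LinearMap.comp_apply, MulOpposite.unop_op,
      LinearMap.mulRight_apply, mul_arw, arw_mul, map_smul]
    fin_cases i <;>
      simp [homAA, homDD, homAD, mul_def, arrowSrc, arrowTgt, vtxDual_vtx, vtxDual_arw,
        arwDual_arw] <;> ring

theorem homDD_mul (x y : EndCoord k) (φ : DualA k) :
    φ ∘ₗ LinearMap.mulRight k (x * y).homDD =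
      MulOpposite.op (y.homDA φ) • x.homAD +
        (φ ∘ₗ LinearMap.mulRight k y.homDD) ∘ₗ LinearMap.mulRight k x.homDD := by
  refine DualA.ext (fun i => ?_) fun i => ?_
  · simp only [LinearMap.add_apply, DualA.op_smul_apply, LinearMap.comp_apply, MulOpposite.unop_op,
      LinearMap.mulRight_apply, homDA_apply, homDD, add_mul, mul_add, smul_mul_assoc, mul_smul_comm,
      vtx_mul_vtx, vtx_mul_arw, arw_mul_vtx, homAD, mul_def, LinearMap.smul_apply, map_add,
      map_smul]
    fin_cases i <;>
      simp [arrowSrc, arrowTgt, vtxDual_arw, arwDual_arw, vtx_mul_vtx,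
        vtx_mul_arw, arw_mul_vtx, arw_mul_arw] <;> ring
  · simp only [LinearMap.add_apply, DualA.op_smul_apply, LinearMap.comp_apply, MulOpposite.unop_op,
      LinearMap.mulRight_apply, mul_arw, arw_mul, map_smul]
    fin_cases i <;>
      simp [homDA_apply, homDD, homAD, mul_def, arrowSrc, arrowTgt, vtxDual_vtx, vtxDual_arw,
        arwDual_arw] <;> ring

theorem toEnd_mul (x y : EndCoord k) : (x * y).toEnd = x.toEnd * y.toEnd := by
  refine LinearMap.ext fun ⟨a, φ⟩ => ?_
  rw [Module.End.mul_apply]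
  simp only [toEnd_apply]
  refine Prod.ext ?_ ?_
  · simp only [homAA_mul, homDA_mul, map_add, homDA_op_smul, MulOpposite.unop_op]
    noncomm_ring
  · simp only [homDD_mul]
    rw [homAD_mul]
    simp only [MulOpposite.op_add, MulOpposite.op_mul, add_smul, mul_smul, smul_add,
      LinearMap.add_comp]
    have : MulOpposite.op a • (y.homAD ∘ₗ LinearMap.mulRight k x.homDD) =
        (MulOpposite.op a • y.homAD) ∘ₗ LinearMap.mulRight k x.homDD := by
      ext z
      simp [DualA.op_smul_apply, mul_assoc]
    rw [this]
    abel

theorem toEnd_add (x y : EndCoord k) : (x + y).toEnd = x.toEnd + y.toEnd := by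
  have hAA : (x + y).homAA = x.homAA + y.homAA := by
    simp only [homAA, add_def, EndCoord.add]; module
  have hAD : (x + y).homAD = x.homAD + y.homAD := by
    simp only [homAD, add_def, EndCoord.add]; module
  have hDD : (x + y).homDD = x.homDD + y.homDD := by
    simp only [homDD, add_def, EndCoord.add]; module
  have hDA : (x + y).homDA = x.homDA + y.homDA := by
    ext φ
    simp only [homDA_apply, add_def, EndCoord.add, LinearMap.add_apply]
    module
  refine LinearMap.ext fun ⟨a, φ⟩ => ?_
  rw [LinearMap.add_apply]
  simp only [toEnd_apply, hAA, hAD, hDD, hDA]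
  refine Prod.ext ?_ (LinearMap.ext fun z => ?_)
  · simp [add_mul]; abel
  · simp [mul_add]; abel

end EndCoord

end

namespace EndCoord

variable {k : Type} [Field k]

/-- The coordinates of an endomorphism. -/
@[simps]
noncomputable def ofEnd (f : EndB k) : EndCoord k where
  p₁ := vtxDual k 0 (f (1, 0)).1
  p₂ := vtxDual k 1 (f (1, 0)).1
  p₃ := vtxDual k 2 (f (1, 0)).1
  u₁ := arwDual k 1 (f (1, 0)).1
  u₃ := arwDual k 2 (f (1, 0)).1
  c₁ := arwDual k 0 (f (1, 0)).1
  c₃ := arwDual k 3 (f (1, 0)).1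
  v₁ := (f (1, 0)).2 (vtx k 0)
  v₃ := (f (1, 0)).2 (vtx k 2)
  d := (f (1, 0)).2 (vtx k 1)
  a₁ := (f (1, 0)).2 (arw k 0)
  a₃ := (f (1, 0)).2 (arw k 3)
  b₁ := (f (1, 0)).2 (arw k 1)
  b₃ := (f (1, 0)).2 (arw k 2)
  q₁ := (f (0, arwDual k 1)).2 (arw k 1)
  q₂ := (f (0, arwDual k 0)).2 (arw k 0)
  q₃ := (f (0, arwDual k 2)).2 (arw k 2)
  s₁ := (f (0, arwDual k 0)).2 (vtx k 0)
  s₃ := (f (0, arwDual k 3)).2 (vtx k 2)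
  h₁ := (f (0, arwDual k 1)).2 (vtx k 1)
  h₃ := (f (0, arwDual k 2)).2 (vtx k 1)
  r₁ := arwDual k 1 (f (0, arwDual k 0)).1
  r₃ := arwDual k 2 (f (0, arwDual k 3)).1
  g₁₁ := arwDual k 0 (f (0, arwDual k 1)).1
  g₁₃ := arwDual k 3 (f (0, arwDual k 1)).1
  g₃₁ := arwDual k 0 (f (0, arwDual k 2)).1
  g₃₃ := arwDual k 3 (f (0, arwDual k 2)).1

theorem ofEnd_toEnd (x : EndCoord k) : ofEnd x.toEnd = x := by
  ext <;> simp [toEnd_apply, homAA, homAD, homDA_apply, homDD, vtxDual_vtx, vtxDual_arw,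
    arwDual_vtx, arwDual_arw, arw_mul, vtx_mul_vtx, vtx_mul_arw, arrowTgt, arrowSrc, mul_add]

end EndCoord

section

variable {k : Type} [Field k]

theorem op_vtx_smul_arwDual (i : Fin 3) (a : Fin 4) :
    MulOpposite.op (vtx k i) • arwDual k a = if i = arrowSrc a then arwDual k a else 0 := by
  ext y
  rw [DualA.op_smul_apply, MulOpposite.unop_op, arwDual_mul, vtxDual_vtx, arwDual_vtx]
  split_ifs <;> simp_all

theorem op_arw_smul_arwDual (b a : Fin 4) :
    MulOpposite.op (arw k b) • arwDual k a = if b = a then vtxDual k (arrowTgt a) else 0 := by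
  ext y
  rw [DualA.op_smul_apply, MulOpposite.unop_op, arwDual_mul, vtxDual_arw, arwDual_arw]
  split_ifs <;> simp_all

theorem MA.smul_def (x : Aop k) (m : MA k) : x • m = (m.1 * x.unop, x • m.2) := rfl

theorem EndB.ext {f g : EndB k} (h1 : f (1, 0) = g (1, 0))
    (hD : ∀ a, f (0, arwDual k a) = g (0, arwDual k a)) : f = g := by
  have hk : ∀ (f : EndB k) (c : k) (m : MA k), f (c • m) = c • f m := fun f c m => by
    have : ∀ m : MA k, c • m = (MulOpposite.op (algebraMap k (AlgA k) c)) • m := fun m => by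
      refine Prod.ext ?_ (LinearMap.ext fun y => ?_)
      · simp [Algebra.smul_def, Algebra.commutes]
      · simp [DualA.op_smul_apply, ← Algebra.smul_def]
    rw [this, this, map_smul]
  have hv : ∀ i, f (0, vtxDual k i) = g (0, vtxDual k i) := fun i => by
    obtain ⟨a, rfl⟩ : ∃ a, arrowTgt a = i := by revert i; decide
    have : ((0, vtxDual k (arrowTgt a)) : MA k) =
        MulOpposite.op (arw k a) • ((0, arwDual k a) : MA k) := by
      rw [MA.smul_def, op_arw_smul_arwDual]; simp
    rw [this, map_smul, map_smul, hD]
  refine LinearMap.ext fun ⟨x, φ⟩ => ?_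
  have hx : ((x, φ) : MA k) = MulOpposite.op x • ((1, 0) : MA k) +
      (∑ i, φ (vtx k i) • ((0, vtxDual k i) : MA k) +
        ∑ a, φ (arw k a) • ((0, arwDual k a) : MA k)) := by
    refine Prod.ext ?_ (DualA.ext (fun i => ?_) fun a => ?_)
    · simp [Prod.fst_sum]
    · simp [Prod.snd_sum, vtxDual_vtx, arwDual_vtx]
    · simp [Prod.snd_sum, vtxDual_arw, arwDual_arw]
  rw [hx]
  simp only [map_add, map_sum, map_smul, hk, h1, hD, hv]

end

section

variable {k : Type} [Field k]

set_option maxHeartbeats 1000000 in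
theorem EndCoord.toEnd_ofEnd (f : EndB k) : (EndCoord.ofEnd f).toEnd = f := by
  have hv : ∀ i a, MulOpposite.op (vtx k i) • f (0, arwDual k a) =
      if i = arrowSrc a then f (0, arwDual k a) else 0 := fun i a => by
    rw [← map_smul, MA.smul_def, op_vtx_smul_arwDual]
    split_ifs <;> simp [Prod.mk_zero_zero]
  have ha : ∀ b a, MulOpposite.op (arw k b) • f (0, arwDual k a) =
      if b = a then f (0, vtxDual k (arrowTgt a)) else 0 := fun b a => by
    rw [← map_smul, MA.smul_def, op_arw_smul_arwDual]
    split_ifs <;> simp [Prod.mk_zero_zero]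
  have hv1 : ∀ i a j, vtxDual k j (f (0, arwDual k a)).1 * vtxDual k j (vtx k i) =
      vtxDual k j (if i = arrowSrc a then f (0, arwDual k a) else 0).1 := fun i a j => by
    rw [← hv, ← vtxDual_mul]; rfl
  have hv2 : ∀ i a b, arwDual k b ((f (0, arwDual k a)).1 * vtx k i) =
      arwDual k b (if i = arrowSrc a then f (0, arwDual k a) else 0).1 := fun i a j => by
    rw [← hv]; rfl
  have ha1 : ∀ b a c, arwDual k c ((f (0, arwDual k a)).1 * arw k b) =
      arwDual k c (if b = a then f (0, vtxDual k (arrowTgt a)) else 0).1 := fun i a j => by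
    rw [← ha]; rfl
  have hv3 : ∀ i a y, (f (0, arwDual k a)).2 (vtx k i * y) =
      (if i = arrowSrc a then f (0, arwDual k a) else 0).2 y := fun i a j => by
    rw [← hv]; rfl
  have ha3 : ∀ b a y, (f (0, arwDual k a)).2 (arw k b * y) =
      (if b = a then f (0, vtxDual k (arrowTgt a)) else 0).2 y := fun i a j => by
    rw [← ha]; rfl
  refine EndB.ext (Prod.ext (AlgA.ext (fun i => ?_) fun i => ?_)
    (DualA.ext (fun i => ?_) fun i => ?_)) fun a =>
      Prod.ext (AlgA.ext (fun i => ?_) fun i => ?_) (DualA.ext (fun i => ?_) fun i => ?_)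
  · fin_cases i <;> simp [toEnd_apply, homAA, vtxDual_vtx, vtxDual_arw]
  · fin_cases i <;> simp [toEnd_apply, homAA, arwDual_vtx, arwDual_arw]
  · fin_cases i <;> simp [toEnd_apply, homAD, vtxDual_vtx, arwDual_vtx]
  · fin_cases i <;> simp [toEnd_apply, homAD, vtxDual_arw, arwDual_arw]
  · simp only [arwDual_mul, arwDual_arw, vtxDual_arw, vtxDual_vtx] at ha1 hv1
    have h1 := (hv1 i a i)
    have h2 := ha1 2 1 2
    have h3 := ha1 1 2 1
    have h4 := (ha1 0 0 0).trans (ha1 3 3 0).symm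
    have h6 := (ha1 3 3 3).trans (ha1 0 0 3).symm
    clear hv ha hv1 hv2 hv3 ha1 ha3
    fin_cases a <;> fin_cases i <;>
      simp_all [toEnd_apply, homDA_apply, vtxDual_arw, arrowSrc]
  · simp only [arwDual_mul, arwDual_vtx, vtxDual_vtx] at hv2
    have h := hv2 (arrowSrc a) a i |>.symm
    clear hv ha hv1 hv2 hv3 ha1 ha3
    fin_cases a <;> fin_cases i <;>
      simp_all [toEnd_apply, homDA_apply, arwDual_arw, arrowSrc, arrowTgt]
  · have h := hv3 (arrowSrc a) a (vtx k i) |>.symm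
    rw [vtx_mul_vtx] at h
    clear hv ha hv1 hv2 hv3 ha1 ha3
    fin_cases a <;> fin_cases i <;>
      simp_all [toEnd_apply, homDD, arwDual_vtx, arwDual_arw, mul_add, vtx_mul_vtx,
        vtx_mul_arw, arrowSrc]
  · have h1 := hv3 (arrowSrc a) a (arw k i) |>.symm
    rw [vtx_mul_arw] at h1
    have h2 := ha3 2 1 1
    have h3 := ha3 1 2 1
    have h4 := (ha3 0 0 1).trans (ha3 3 3 1).symm
    clear hv ha hv1 hv2 hv3 ha1 ha3
    fin_cases a <;> fin_cases i <;>
      simp_all [toEnd_apply, homDD, arwDual_arw, arw_mul, vtxDual_vtx, vtxDual_arw, arrowSrc,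
        arrowTgt]

end

namespace EndCoord

variable {k : Type} [Field k]

/-- The zero coordinates. -/
@[simps]
protected def zero : EndCoord k where
  p₁ := 0
  p₂ := 0
  p₃ := 0
  u₁ := 0
  u₃ := 0
  c₁ := 0
  c₃ := 0
  v₁ := 0
  v₃ := 0
  d := 0
  a₁ := 0
  a₃ := 0
  b₁ := 0
  b₃ := 0
  q₁ := 0
  q₂ := 0
  q₃ := 0
  s₁ := 0
  s₃ := 0
  h₁ := 0
  h₃ := 0
  r₁ := 0
  r₃ := 0
  g₁₁ := 0
  g₁₃ := 0
  g₃₁ := 0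
  g₃₃ := 0

instance : Zero (EndCoord k) := ⟨EndCoord.zero⟩

theorem zero_def : (0 : EndCoord k) = EndCoord.zero := rfl

theorem add_zero' (x : EndCoord k) : x + 0 = x := by ext <;> simp [add_def, zero_def]

/-- The diagonal coordinates. -/
def residue (x : EndCoord k) : Fin 6 → k := ![x.p₁, x.p₂, x.p₃, x.q₁, x.q₂, x.q₃]

/-- Coordinates of a syzygy of a principal left ideal. -/
structure IsSyzygy (ε φ ψ : EndCoord k) : Prop where
  idem : ε * ε = ε
  mul_left : φ * ε = φ
  mul_right : ε * ψ = ψ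
  mul_eq_zero : φ * ψ = 0
  exists_mul : ∀ x, ε * x = x → φ * x = 0 → ∃ y, ψ * y = x

end EndCoord

/-- A ring whose opposite is the coordinate ring `EndCoord k`. -/
structure CoordEquiv (k : Type) [Field k] (R : Type) [Ring R] extends EndCoord k ≃ R where
  map_mul_rev' : ∀ x y, toFun x * toFun y = toFun (y * x)
  map_add_rev' : ∀ x y, toFun x + toFun y = toFun (x + y)

namespace CoordEquiv

variable {k : Type} [Field k] {R : Type} [Ring R] (e : CoordEquiv k R)

instance : CoeFun (CoordEquiv k R) fun _ => EndCoord k → R := ⟨fun e => e.toEquiv⟩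

theorem mul_eq (x y : EndCoord k) : e x * e y = e (y * x) := e.map_mul_rev' x y

theorem add_eq (x y : EndCoord k) : e x + e y = e (x + y) := e.map_add_rev' x y

theorem map_zero : e 0 = 0 := by
  have := e.add_eq 0 0
  rwa [EndCoord.add_zero', add_eq_left] at this

theorem inj {x y : EndCoord k} : e x = e y ↔ x = y := e.injective.eq_iff

theorem eq_zero {x : EndCoord k} : e x = 0 ↔ x = 0 := by rw [← e.map_zero, e.inj]

/-- The semisimple quotient of the ring. -/
def residue : R →+* (Fin 6 → k) where
  toFun r := (e.symm r).residue
  map_one' := by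
    obtain ⟨x, hx⟩ := e.surjective 1
    let y : EndCoord k :=
      { EndCoord.zero with p₁ := 1, p₂ := 1, p₃ := 1, q₁ := 1, q₂ := 1, q₃ := 1 }
    have h : y * x = y := by rw [← e.inj, ← e.mul_eq, hx, one_mul]
    rw [← hx, e.symm_apply_apply]
    simp only [EndCoord.ext_iff, EndCoord.mul_def, EndCoord.mul, one_mul, y] at h
    ext i
    fin_cases i <;> simp [EndCoord.residue, h]
  map_mul' r s := by
    obtain ⟨x, rfl⟩ := e.surjective r
    obtain ⟨y, rfl⟩ := e.surjective s
    rw [e.mul_eq]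
    simp only [e.symm_apply_apply]
    ext i
    fin_cases i <;> simp [EndCoord.residue, EndCoord.mul_def, mul_comm]
  map_zero' := by
    rw [← e.map_zero, e.symm_apply_apply]
    ext i
    fin_cases i <;> rfl
  map_add' r s := by
    obtain ⟨x, rfl⟩ := e.surjective r
    obtain ⟨y, rfl⟩ := e.surjective s
    rw [e.add_eq]
    simp only [e.symm_apply_apply]
    ext i
    fin_cases i <;> simp [EndCoord.residue, EndCoord.add_def]

theorem residue_apply (x : EndCoord k) : e.residue (e x) = x.residue :=
  congrArg EndCoord.residue (e.symm_apply_apply x)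

theorem residue_surjective : Function.Surjective e.residue := fun z =>
  ⟨e { EndCoord.zero with
    p₁ := z 0, p₂ := z 1, p₃ := z 2, q₁ := z 3, q₂ := z 4, q₃ := z 5 }, by
    rw [residue_apply]
    ext i
    fin_cases i <;> rfl⟩

theorem mem_ker_residue {x : EndCoord k} : e x ∈ RingHom.ker e.residue ↔
    x.p₁ = 0 ∧ x.p₂ = 0 ∧ x.p₃ = 0 ∧ x.q₁ = 0 ∧ x.q₂ = 0 ∧ x.q₃ = 0 := by
  rw [RingHom.mem_ker, residue_apply]
  simp [EndCoord.residue, funext_iff, Fin.forall_fin_succ]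

instance : IsSemisimpleRing (R ⧸ RingHom.ker e.residue) :=
  (RingHom.quotientKerEquivOfSurjective e.residue_surjective).symm.isSemisimpleRing

theorem ker_residue_nilpotent (x : R) (hx : x ∈ RingHom.ker e.residue)
    (y : R) (hy : y ∈ RingHom.ker e.residue) (z : R) (hz : z ∈ RingHom.ker e.residue)
    (w : R) (hw : w ∈ RingHom.ker e.residue) : x * y * z * w = 0 := by
  obtain ⟨x, rfl⟩ := e.surjective x
  obtain ⟨y, rfl⟩ := e.surjective y
  obtain ⟨z, rfl⟩ := e.surjective z
  obtain ⟨w, rfl⟩ := e.surjective w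
  rw [mem_ker_residue] at hx hy hz hw
  rw [e.mul_eq, e.mul_eq, e.mul_eq, e.eq_zero]
  ext <;> simp [EndCoord.mul_def, EndCoord.zero_def, hx, hy, hz, hw]

/-- The left ideal generated by the element with given coordinates, as a module. -/
abbrev principal (φ : EndCoord k) : ModuleCat R :=
  ModuleCat.of R (Submodule.span R {e φ})

theorem hasProjectiveDimensionLT_principal_zero :
    HasProjectiveDimensionLT (e.principal 0) 0 := by
  have : Subsingleton (Submodule.span R {e 0}) := by
    rw [e.map_zero, Submodule.span_zero_singleton]
    infer_instance
  exact (ModuleCat.isZero_of_subsingleton _).hasProjectiveDimensionLT_zero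

end CoordEquiv

namespace EndCoord.IsSyzygy

variable {k : Type} [Field k] {R : Type} [Ring R] {ε φ ψ : EndCoord k}

theorem exists_mul_eq (h : IsSyzygy ε φ ψ) (e : CoordEquiv k R) (x : R) (hx : x * e ε = x)
    (hφ : x * e φ = 0) : ∃ y, y * e ψ = x := by
  obtain ⟨x, rfl⟩ := e.surjective x
  rw [e.mul_eq, e.inj] at hx
  rw [e.mul_eq, e.eq_zero] at hφ
  obtain ⟨y, rfl⟩ := h.exists_mul x hx hφ
  exact ⟨e y, e.mul_eq _ _⟩

theorem hasProjectiveDimensionLT (h : IsSyzygy ε φ ψ) (e : CoordEquiv k R) {n : ℕ}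
    (hn : HasProjectiveDimensionLT (e.principal ψ) n) :
    HasProjectiveDimensionLT (e.principal φ) (n + 1) :=
  hasProjectiveDimensionLT_span_singleton (ε := e ε) n (by rw [e.mul_eq, h.idem])
    (by rw [e.mul_eq, h.mul_left]) (by rw [e.mul_eq, h.mul_right])
    (by rw [e.mul_eq, h.mul_eq_zero, e.map_zero]) (h.exists_mul_eq e) hn

theorem hasProjectiveDimensionLT_syzygy (h : IsSyzygy ε φ ψ) (e : CoordEquiv k R) {n : ℕ}
    (hn : HasProjectiveDimensionLT (e.principal φ) (n + 2)) :
    HasProjectiveDimensionLT (e.principal ψ) (n + 1) :=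
  hasProjectiveDimensionLT_span_singleton_syzygy (ε := e ε) n (by rw [e.mul_eq, h.idem])
    (by rw [e.mul_eq, h.mul_left]) (by rw [e.mul_eq, h.mul_right])
    (by rw [e.mul_eq, h.mul_eq_zero, e.map_zero]) (h.exists_mul_eq e) hn

end EndCoord.IsSyzygy

/-- The opposite of the endomorphism ring in coordinates. -/
noncomputable def endCoordEquiv (k : Type) [Field k] : CoordEquiv k (Bop k) where
  toFun x := MulOpposite.op x.toEnd
  invFun f := EndCoord.ofEnd f.unop
  left_inv x := EndCoord.ofEnd_toEnd x
  right_inv f := congrArg MulOpposite.op (EndCoord.toEnd_ofEnd f.unop)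
  map_mul_rev' x y := congrArg MulOpposite.op (EndCoord.toEnd_mul y x).symm
  map_add_rev' x y := congrArg MulOpposite.op (EndCoord.toEnd_add x y).symm

namespace EndCoord

variable {k : Type} [Field k]

/-- The idempotent of the summand `e₁A`. -/
def idP₁ : EndCoord k := { EndCoord.zero with p₁ := 1 }

/-- The idempotent of the summand `e₂A`. -/
def idP₂ : EndCoord k := { EndCoord.zero with p₂ := 1 }

/-- The idempotent of the summand `e₃A`. -/
def idP₃ : EndCoord k := { EndCoord.zero with p₃ := 1 }

/-- The idempotent of the summand `e₁A ⊕ e₃A`. -/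
def idP₁P₃ : EndCoord k := { EndCoord.zero with p₁ := 1, p₃ := 1 }

/-- The idempotent of the summand `D(Ae₂)`. -/
def idI₂ : EndCoord k := { EndCoord.zero with q₂ := 1 }

/-- The idempotent of the summand `D(Ae₁) ⊕ D(Ae₃)`. -/
def idI₁I₃ : EndCoord k := { EndCoord.zero with q₁ := 1, q₃ := 1 }

/-- The inclusion `e₁A → D(Ae₂)`. -/
def mapA₁ : EndCoord k := { EndCoord.zero with a₁ := 1 }

/-- The inclusion `e₃A → D(Ae₂)`. -/
def mapA₃ : EndCoord k := { EndCoord.zero with a₃ := 1 }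

/-- The sum `e₁A ⊕ e₃A → D(Ae₂)` of the inclusions. -/
def mapASum : EndCoord k := { EndCoord.zero with a₁ := 1, a₃ := 1 }

/-- The map `D(Ae₂) → e₂A` with image the copy of `S₁` in the socle. -/
def mapR₁ : EndCoord k := { EndCoord.zero with r₁ := 1 }

/-- The map `D(Ae₂) → e₂A` with image the copy of `S₃` in the socle. -/
def mapR₃ : EndCoord k := { EndCoord.zero with r₃ := 1 }

/-- The projection `e₂A → D(Ae₁)`. -/
def mapB₁ : EndCoord k := { EndCoord.zero with b₁ := 1 }

/-- The projection `e₂A → D(Ae₃)`. -/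
def mapB₃ : EndCoord k := { EndCoord.zero with b₃ := 1 }

/-- The difference `e₂A → D(Ae₁) ⊕ D(Ae₃)` of the projections. -/
def mapBDiff : EndCoord k := { EndCoord.zero with b₁ := 1, b₃ := -1 }

/-- The map `D(Ae₁) ⊕ D(Ae₃) → e₁A` with image the socle. -/
def mapG₁ : EndCoord k := { EndCoord.zero with g₁₁ := 1, g₃₁ := 1 }

/-- The map `D(Ae₁) ⊕ D(Ae₃) → e₃A` with image the socle. -/
def mapG₃ : EndCoord k := { EndCoord.zero with g₁₃ := 1, g₃₃ := 1 }

/-- The difference `D(Ae₁) ⊕ D(Ae₃) → e₁A ⊕ e₃A` of the maps onto the socles. -/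
def mapGDiff : EndCoord k := { EndCoord.zero with g₁₁ := 1, g₃₁ := 1, g₁₃ := -1, g₃₃ := -1 }

theorem isSyzygy_mapA₁ : IsSyzygy (k := k) idP₁ mapA₁ 0 := by
  refine ⟨?_, ?_, ?_, ?_, fun x hx h => ⟨0, ?_⟩⟩
  on_goal 5 => rw [eq_comm, EndCoord.ext_iff] at hx
  all_goals simp_all [EndCoord.ext_iff, mul_def, zero_def, idP₁, mapA₁]

theorem isSyzygy_mapA₃ : IsSyzygy (k := k) idP₃ mapA₃ 0 := by
  refine ⟨?_, ?_, ?_, ?_, fun x hx h => ⟨0, ?_⟩⟩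
  on_goal 5 => rw [eq_comm, EndCoord.ext_iff] at hx
  all_goals simp_all [EndCoord.ext_iff, mul_def, zero_def, idP₃, mapA₃]

theorem isSyzygy_mapR₁ : IsSyzygy (k := k) idI₂ mapR₁ mapA₃ := by
  refine ⟨?_, ?_, ?_, ?_, fun x hx h => ⟨{ EndCoord.zero with
    p₃ := x.a₃, c₃ := x.d, g₁₃ := x.h₁, g₃₃ := x.h₃ }, ?_⟩⟩
  on_goal 5 => rw [eq_comm, EndCoord.ext_iff] at hx
  all_goals simp_all [EndCoord.ext_iff, mul_def, zero_def, idI₂, mapR₁, mapA₃]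

theorem isSyzygy_mapR₃ : IsSyzygy (k := k) idI₂ mapR₃ mapA₁ := by
  refine ⟨?_, ?_, ?_, ?_, fun x hx h => ⟨{ EndCoord.zero with
    p₁ := x.a₁, c₁ := x.d, g₁₁ := x.h₁, g₃₁ := x.h₃ }, ?_⟩⟩
  on_goal 5 => rw [eq_comm, EndCoord.ext_iff] at hx
  all_goals simp_all [EndCoord.ext_iff, mul_def, zero_def, idI₂, mapR₃, mapA₁]

theorem isSyzygy_mapBDiff : IsSyzygy (k := k) idP₂ mapBDiff 0 := by
  refine ⟨?_, ?_, ?_, ?_, fun x hx h => ⟨0, ?_⟩⟩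
  on_goal 5 => rw [eq_comm, EndCoord.ext_iff] at hx
  all_goals simp_all [EndCoord.ext_iff, mul_def, zero_def, idP₂, mapBDiff]

theorem isSyzygy_mapG₁ : IsSyzygy (k := k) idI₁I₃ mapG₁ mapBDiff := by
  refine ⟨?_, ?_, ?_, ?_, fun x hx h => ⟨{ EndCoord.zero with
    p₂ := x.b₁, u₁ := x.v₁, u₃ := -x.v₃, r₁ := x.s₁, r₃ := -x.s₃ }, ?_⟩⟩
  on_goal 5 => rw [eq_comm, EndCoord.ext_iff] at hx
  all_goals simp_all [EndCoord.ext_iff, mul_def, zero_def, idI₁I₃, mapG₁, mapBDiff,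
    neg_eq_iff_add_eq_zero]

theorem isSyzygy_mapG₃ : IsSyzygy (k := k) idI₁I₃ mapG₃ mapBDiff := by
  refine ⟨?_, ?_, ?_, ?_, fun x hx h => ⟨{ EndCoord.zero with
    p₂ := x.b₁, u₁ := x.v₁, u₃ := -x.v₃, r₁ := x.s₁, r₃ := -x.s₃ }, ?_⟩⟩
  on_goal 5 => rw [eq_comm, EndCoord.ext_iff] at hx
  all_goals simp_all [EndCoord.ext_iff, mul_def, zero_def, idI₁I₃, mapG₃, mapBDiff,
    neg_eq_iff_add_eq_zero]

theorem isSyzygy_mapB₁ : IsSyzygy (k := k) idP₂ mapB₁ mapR₃ := by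
  refine ⟨?_, ?_, ?_, ?_, fun x hx h => ⟨{ EndCoord.zero with
    q₂ := x.r₃, a₃ := x.u₃ }, ?_⟩⟩
  on_goal 5 => rw [eq_comm, EndCoord.ext_iff] at hx
  all_goals simp_all [EndCoord.ext_iff, mul_def, zero_def, idP₂, mapB₁, mapR₃]

theorem isSyzygy_mapB₃ : IsSyzygy (k := k) idP₂ mapB₃ mapR₁ := by
  refine ⟨?_, ?_, ?_, ?_, fun x hx h => ⟨{ EndCoord.zero with
    q₂ := x.r₁, a₁ := x.u₁ }, ?_⟩⟩
  on_goal 5 => rw [eq_comm, EndCoord.ext_iff] at hx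
  all_goals simp_all [EndCoord.ext_iff, mul_def, zero_def, idP₂, mapB₃, mapR₁]

theorem isSyzygy_mapGDiff : IsSyzygy (k := k) idI₁I₃ mapGDiff mapBDiff := by
  refine ⟨?_, ?_, ?_, ?_, fun x hx h => ⟨{ EndCoord.zero with
    p₂ := x.b₁, u₁ := x.v₁, u₃ := -x.v₃, r₁ := x.s₁, r₃ := -x.s₃ }, ?_⟩⟩
  on_goal 5 => rw [eq_comm, EndCoord.ext_iff] at hx
  all_goals simp_all [EndCoord.ext_iff, mul_def, zero_def, idI₁I₃, mapGDiff, mapBDiff,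
    neg_eq_iff_add_eq_zero]

theorem isSyzygy_mapASum : IsSyzygy (k := k) idP₁P₃ mapASum mapGDiff := by
  refine ⟨?_, ?_, ?_, ?_, fun x hx h => ⟨{ EndCoord.zero with
    q₁ := x.g₁₁, q₃ := x.g₃₁, b₁ := x.c₁ }, ?_⟩⟩
  on_goal 5 => rw [eq_comm, EndCoord.ext_iff] at hx
  all_goals simp_all [EndCoord.ext_iff, mul_def, zero_def, idP₁P₃, mapASum, mapGDiff,
    neg_eq_iff_add_eq_zero]

/-- Generators of the radical, as a direct sum of principal left ideals. -/
def radicalGenerator : Fin 7 → EndCoord k :=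
  ![mapG₁, mapG₃, mapR₁, mapR₃, mapB₁, mapB₃, mapASum]

/-- The components of an element of the radical with respect to `radicalGenerator`. -/
def radicalComponent (x : EndCoord k) : Fin 7 → EndCoord k :=
  ![{ EndCoord.zero with b₁ := x.c₁, q₁ := x.g₁₁, q₃ := x.g₃₁ },
    { EndCoord.zero with b₁ := x.c₃, q₁ := x.g₁₃, q₃ := x.g₃₃ },
    { EndCoord.zero with a₁ := x.u₁, q₂ := x.r₁ },
    { EndCoord.zero with a₃ := x.u₃, q₂ := x.r₃ },
    { EndCoord.zero with u₁ := x.v₁, p₂ := x.b₁, r₁ := x.s₁ },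
    { EndCoord.zero with u₃ := x.v₃, p₂ := x.b₃, r₃ := x.s₃ },
    { EndCoord.zero with p₁ := x.a₁, p₃ := x.a₃, c₁ := x.d, g₁₁ := x.h₁, g₃₁ := x.h₃ }]

end EndCoord

namespace CoordEquiv

open EndCoord

variable {k : Type} [Field k] {R : Type} [Ring R] (e : CoordEquiv k R)

theorem hasProjectiveDimensionLT_radicalGenerator (i : Fin 7) :
    HasProjectiveDimensionLT (e.principal (radicalGenerator i)) 3 := by
  have h0 := e.hasProjectiveDimensionLT_principal_zero
  have hR₁ := isSyzygy_mapR₁.hasProjectiveDimensionLT e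
    (isSyzygy_mapA₃.hasProjectiveDimensionLT e h0)
  have hR₃ := isSyzygy_mapR₃.hasProjectiveDimensionLT e
    (isSyzygy_mapA₁.hasProjectiveDimensionLT e h0)
  have hB := isSyzygy_mapBDiff.hasProjectiveDimensionLT e h0
  have hG₁ := isSyzygy_mapG₁.hasProjectiveDimensionLT e hB
  have hG₃ := isSyzygy_mapG₃.hasProjectiveDimensionLT e hB
  fin_cases i
  · exact hasProjectiveDimensionLT_of_ge (e.principal mapG₁) 2 3 (by simp)
  · exact hasProjectiveDimensionLT_of_ge (e.principal mapG₃) 2 3 (by simp)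
  · exact hasProjectiveDimensionLT_of_ge (e.principal mapR₁) 2 3 (by simp)
  · exact hasProjectiveDimensionLT_of_ge (e.principal mapR₃) 2 3 (by simp)
  · exact isSyzygy_mapB₁.hasProjectiveDimensionLT e hR₃
  · exact isSyzygy_mapB₃.hasProjectiveDimensionLT e hR₁
  · exact isSyzygy_mapASum.hasProjectiveDimensionLT e
      (isSyzygy_mapGDiff.hasProjectiveDimensionLT e hB)

theorem hasProjectiveDimensionLT_ker_residue :
    HasProjectiveDimensionLT (ModuleCat.of R (RingHom.ker e.residue)) 3 := by
  refine hasProjectiveDimensionLT_of_principal_decomposition _ 3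
    (fun i => e (radicalGenerator i)) (fun i => ?_) (fun x hx => ?_) (fun y hy => ?_)
    e.hasProjectiveDimensionLT_radicalGenerator
  · rw [mem_ker_residue]
    fin_cases i <;>
      simp [radicalGenerator, mapG₁, mapG₃, mapR₁, mapR₃, mapB₁, mapB₃, mapASum]
  · obtain ⟨x, rfl⟩ := e.surjective x
    rw [mem_ker_residue] at hx
    refine ⟨fun i => e (radicalComponent x i), ?_⟩
    simp only [Fin.sum_univ_seven, e.mul_eq, e.add_eq, e.inj]
    ext <;> simp [radicalGenerator, radicalComponent, mapG₁, mapG₃, mapR₁, mapR₃, mapB₁, mapB₃,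
      mapASum, mul_def, add_def, hx]
  · obtain ⟨z, rfl⟩ : ∃ z : Fin 7 → EndCoord k, y = fun i => e (z i) :=
      ⟨fun i => e.symm (y i), funext fun i => (e.apply_symm_apply _).symm⟩
    simp only [Fin.sum_univ_seven, e.mul_eq, e.add_eq, e.eq_zero] at hy ⊢
    simp [radicalGenerator, mapG₁, mapG₃, mapR₁, mapR₃, mapB₁, mapB₃, mapASum, mul_def, add_def,
      zero_def, EndCoord.ext_iff] at hy
    intro i
    fin_cases i <;> simp [radicalGenerator, mapG₁, mapG₃, mapR₁, mapR₃, mapB₁, mapB₃, mapASum,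
      mul_def, zero_def, EndCoord.ext_iff, hy]

theorem hasProjectiveDimensionLT_four (e : CoordEquiv k R) (N : ModuleCat.{0} R) :
    HasProjectiveDimensionLT N 4 :=
  hasProjectiveDimensionLT_of_nilpotent _ 3 e.hasProjectiveDimensionLT_ker_residue
    e.ker_residue_nilpotent N

theorem not_hasProjectiveDimensionLT_three :
    ¬ HasProjectiveDimensionLT (ModuleCat.of R (R ⧸ Submodule.span R {e mapB₁})) 3 := fun h => by
  have h₁ := isSyzygy_mapB₁.hasProjectiveDimensionLT_syzygy e (n := 0)
    (hasProjectiveDimensionLT_of_quotient (Submodule.span R {e mapB₁}) 1 h)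
  obtain ⟨q, hq, hann⟩ := exists_mul_eq_of_projective_span_singleton h₁
  obtain ⟨q, rfl⟩ := e.surjective q
  have ha := hann (e mapA₁) (by
    rw [e.mul_eq, e.eq_zero]
    ext <;> simp [mapA₁, mapR₃, mul_def, zero_def])
  rw [e.mul_eq, e.inj] at hq
  rw [e.mul_eq, e.eq_zero] at ha
  have hq₂ : q.q₂ = 1 := by simpa [mapR₃, mul_def] using congrArg EndCoord.r₃ hq
  have := congrArg EndCoord.a₁ ha
  simp [mapA₁, mul_def, zero_def, hq₂] at this

end CoordEquiv

/-- The endomorphism algebra `B = End_A(A ⊕ D(A))` has global dimension exactly `3`: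
`Ext⁴_B` vanishes identically and `Ext³_B` does not. -/
theorem endB_global_dimension_eq_three (k : Type) [Field k] :
    (∀ X Y : ModuleCat (Bop k), Subsingleton (ExtB k X Y 4)) ∧
    (∃ X Y : ModuleCat (Bop k), Nontrivial (ExtB k X Y 3)) := by
  refine ⟨fun X Y => (hasProjectiveDimensionLT_succ_iff X 3).1
    ((endCoordEquiv k).hasProjectiveDimensionLT_four X) Y, ?_⟩
  by_contra! h
  exact (endCoordEquiv k).not_hasProjectiveDimensionLT_three
    ((hasProjectiveDimensionLT_succ_iff _ 2).2 fun Y => h _ Y)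
end

section
/- The endomorphism algebra B := End_A(A ⊕ D(A)) is a higher Auslander algebra: its global dimension and its dominant dimension are both equal to 3. In particular, in a minimal injective coresolution 0 → B → I⁰ → I¹ → I² → ⋯ of the regular right B-module, the terms I⁰, I¹ and I² are projective while I³ is not. -/
/-!
We formalize statements about the algebra `A = kQ/J²`, where `Q` is the quiver
`1 ⇄ 2 ⇄ 3` and `J` is the arrow ideal of the path algebra `kQ`.
The algebra `A` is presented by generators and relations as a quotient of the
free algebra on three vertex idempotents and four arrows.
Right `A`-modules are treated as left modules over `Aᵐᵒᵖ`.
-/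

open CategoryTheory Opposite

/-- The linear map `f : M → N` has essential image: the range of `f` intersects
every nonzero submodule of `N` nontrivially. -/
def EssentialRange {R M N : Type} [Ring R] [AddCommGroup M] [Module R M]
    [AddCommGroup N] [Module R N] (f : M →ₗ[R] N) : Prop :=
  ∀ K : Submodule R N, K ≠ ⊥ → LinearMap.range f ⊓ K ≠ ⊥

section ExtBridge

variable {C : Type*} [Category* C] [Abelian C] [EnoughProjectives C]

lemma subsingleton_Ext_iff {X : C} (P : ProjectiveResolution X) (Y : C) (n : ℕ) :
    Subsingleton (((Ext ℤ C (n + 1)).obj (op X)).obj Y) ↔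
      ∀ f : P.complex.X (n + 1) ⟶ Y, P.complex.d (n + 2) (n + 1) ≫ f = 0 →
        ∃ g : P.complex.X n ⟶ Y, P.complex.d (n + 1) n ≫ g = f := by
  rw [← ModuleCat.isZero_iff_subsingleton, (P.isoExt (R := ℤ) (n + 1) Y).isZero_iff,
    ← HomologicalComplex.exactAt_iff_isZero_homology,
    HomologicalComplex.exactAt_iff' _ n (n + 1) (n + 2) (by simp) (by simp),
    ShortComplex.moduleCat_exact_iff]
  exact Iff.rfl

variable [EnoughInjectives C]

lemma hasProjectiveDimensionLT_iff_subsingleton_Ext (X : C) (n : ℕ) :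
    HasProjectiveDimensionLT X (n + 1) ↔
      ∀ Y : C, Subsingleton (((Ext ℤ C (n + 1)).obj (op X)).obj Y) := by
  let := HasExt.standard C
  let P := ProjectiveResolution.of X
  have key (Y : C) : Subsingleton (Abelian.Ext X Y (n + 1)) ↔
      Subsingleton (((Ext ℤ C (n + 1)).obj (op X)).obj Y) := by
    rw [subsingleton_Ext_iff P]
    constructor
    · intro h f hf
      rw [← P.extMk_eq_zero_iff f (n + 2) rfl hf n rfl]
      exact Subsingleton.elim _ _
    · intro h
      refine subsingleton_of_forall_eq 0 fun α ↦ ?_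
      obtain ⟨f, hf, rfl⟩ := P.extMk_surjective α (n + 2) rfl
      rw [P.extMk_eq_zero_iff f (n + 2) rfl hf n rfl]
      exact h f hf
  constructor
  · intro h Y
    exact (key Y).1 (HasProjectiveDimensionLT.subsingleton X (n + 1) _ le_rfl Y)
  · intro h
    exact hasProjectiveDimensionLT_of_enoughInjectives X (n + 1) fun Y ↦ (key Y).2 (h Y)

end ExtBridge

section ModulePd

universe u

variable {R : Type u} [Ring R]

/-- The projective dimension of the `R`-module `X` is at most `n`. -/
abbrev ModulePdLE (R : Type u) [Ring R] (n : ℕ) (X : Type u) [AddCommGroup X] [Module R X] : Prop :=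
  HasProjectiveDimensionLT (ModuleCat.of R X) (n + 1)

variable {X Y Z : Type u} [AddCommGroup X] [Module R X] [AddCommGroup Y] [Module R Y]
  [AddCommGroup Z] [Module R Z]

lemma shortExact_of_exact {f : X →ₗ[R] Y} {g : Y →ₗ[R] Z} (hf : Function.Injective f)
    (hfg : Function.Exact f g) (hg : Function.Surjective g) :
    (ShortComplex.mk (ModuleCat.ofHom f) (ModuleCat.ofHom g)
      (by ext x; exact hfg.apply_apply_eq_zero x)).ShortExact where
  exact := by
    rw [ShortComplex.ShortExact.moduleCat_exact_iff_function_exact]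
    exact hfg
  mono_f := (ModuleCat.mono_iff_injective _).2 hf
  epi_g := (ModuleCat.epi_iff_surjective _).2 hg

lemma modulePdLE_zero_iff : ModulePdLE R 0 X ↔ Module.Projective R X := by
  rw [IsProjective.iff_projective]
  exact projective_iff_hasProjectiveDimensionLT_one.symm

lemma ModulePdLE.mono {m n : ℕ} (hmn : m ≤ n) (h : ModulePdLE R m X) : ModulePdLE R n X :=
  have : HasProjectiveDimensionLT (ModuleCat.of R X) (m + 1) := h
  hasProjectiveDimensionLT_of_ge _ (m + 1) _ (by lia)

lemma ModulePdLE.congr {n : ℕ} (e : X ≃ₗ[R] Y) (h : ModulePdLE R n X) : ModulePdLE R n Y :=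
  have : HasProjectiveDimensionLT (ModuleCat.of R X) (n + 1) := h
  hasProjectiveDimensionLT_of_iso e.toModuleIso _

lemma ModulePdLE.of_exact {n : ℕ} {f : X →ₗ[R] Y} {g : Y →ₗ[R] Z} (hf : Function.Injective f)
    (hfg : Function.Exact f g) (hg : Function.Surjective g) (hX : ModulePdLE R n X)
    (hZ : ModulePdLE R n Z) : ModulePdLE R n Y :=
  (shortExact_of_exact hf hfg hg).hasProjectiveDimensionLT_X₂ _ hX hZ

lemma modulePdLE_succ_iff {n : ℕ} {f : X →ₗ[R] Y} {g : Y →ₗ[R] Z} (hf : Function.Injective f)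
    (hfg : Function.Exact f g) (hg : Function.Surjective g) [Module.Projective R Y] :
    ModulePdLE R (n + 1) Z ↔ ModulePdLE R n X :=
  (shortExact_of_exact hf hfg hg).hasProjectiveDimensionLT_X₃_iff n
    ((IsProjective.iff_projective _).1 ‹_›)

lemma modulePdLE_range_iff {n : ℕ} (f : X →ₗ[R] Y) [Module.Projective R X] :
    ModulePdLE R (n + 1) (LinearMap.range f) ↔ ModulePdLE R n (LinearMap.ker f) :=
  modulePdLE_succ_iff (f := (LinearMap.ker f).subtype) (g := f.rangeRestrict)
    (Submodule.injective_subtype _)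
    (LinearMap.exact_iff.2 (by simp)) f.surjective_rangeRestrict

lemma modulePdLE_quotient_iff {n : ℕ} (N : Submodule R X) [Module.Projective R X] :
    ModulePdLE R (n + 1) (X ⧸ N) ↔ ModulePdLE R n N :=
  modulePdLE_succ_iff (f := N.subtype) (g := N.mkQ) (Submodule.injective_subtype _)
    (LinearMap.exact_iff.2 (by simp)) N.mkQ_surjective

lemma ModulePdLE.of_submodule {n : ℕ} (N : Submodule R X) (h : ModulePdLE R n N)
    (h' : ModulePdLE R n (X ⧸ N)) : ModulePdLE R n X :=
  .of_exact (f := N.subtype) (g := N.mkQ) (Submodule.injective_subtype _)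
    (LinearMap.exact_iff.2 (by simp)) N.mkQ_surjective h h'

lemma ModulePdLE.dfinsupp {ι : Type u} {n : ℕ} (N : ι → Type u) [∀ i, AddCommGroup (N i)]
    [∀ i, Module R (N i)] (h : ∀ i, ModulePdLE R n (N i)) : ModulePdLE R n (Π₀ i, N i) := by
  induction n generalizing N with
  | zero =>
    have (i : ι) : Module.Projective R (N i) := modulePdLE_zero_iff.1 (h i)
    exact modulePdLE_zero_iff.2 inferInstance
  | succ n ih =>
    let g (i : ι) : (N i →₀ R) →ₗ[R] N i := Finsupp.linearCombination R id
    have hg (i : ι) : Function.Surjective (g i) := Finsupp.linearCombination_id_surjective R (N i)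
    have hK (i : ι) : ModulePdLE R n (LinearMap.ker (g i)) :=
      (modulePdLE_succ_iff (f := (LinearMap.ker (g i)).subtype) (Submodule.injective_subtype _)
        (LinearMap.exact_iff.2 (by simp)) (hg i)).1 (h i)
    refine (modulePdLE_succ_iff (Y := Π₀ i, N i →₀ R)
      (f := DFinsupp.mapRange.linearMap fun i ↦ (LinearMap.ker (g i)).subtype)
      (g := DFinsupp.mapRange.linearMap g) ?_ ?_ ?_).2 (ih _ hK)
    · exact (DFinsupp.mapRange_injective _ fun _ ↦ map_zero _).2
        fun i ↦ Submodule.injective_subtype _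
    · rw [LinearMap.exact_iff, DFinsupp.ker_mapRangeLinearMap, DFinsupp.range_mapRangeLinearMap]
      simp
    · exact (DFinsupp.mapRange_surjective _ fun _ ↦ map_zero _).2 hg

end ModulePd

section InjectiveResolution

variable {R : Type} [Ring R] {X Y Z J : Type} [AddCommGroup X] [Module R X] [AddCommGroup Y]
  [Module R Y] [AddCommGroup Z] [Module R Z] [AddCommGroup J] [Module R J]

lemma Module.Injective.exists_extension_of_exact [Module.Injective R J] {f : X →ₗ[R] Y}
    {g : Y →ₗ[R] Z} (hfg : LinearMap.ker g = LinearMap.range f) (φ : Y →ₗ[R] J)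
    (hφ : φ ∘ₗ f = 0) : ∃ ψ : Z →ₗ[R] J, ψ ∘ₗ g = φ := by
  have hker : LinearMap.ker g ≤ LinearMap.ker φ := by
    rw [hfg, LinearMap.range_le_ker_iff, hφ]
  obtain ⟨ψ, hψ⟩ := Module.Injective.out ((LinearMap.ker g).liftQ g le_rfl)
    (LinearMap.ker_eq_bot.1 (Submodule.ker_liftQ_eq_bot _ _ _ le_rfl))
    ((LinearMap.ker g).liftQ φ hker)
  exact ⟨ψ, LinearMap.ext fun y ↦ by simpa using hψ (Submodule.Quotient.mk y)⟩

lemma Module.Injective.of_leftInverse [Module.Injective R J] (i : X →ₗ[R] J) (r : J →ₗ[R] X)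
    (h : r ∘ₗ i = LinearMap.id) : Module.Injective R X where
  out A B _ _ _ _ f hf g := by
    obtain ⟨k, hk⟩ := Module.Injective.out f hf (i ∘ₗ g)
    exact ⟨r ∘ₗ k, fun x ↦ by simpa [hk] using LinearMap.congr_fun h (g x)⟩

lemma EssentialRange.injective_of_disjoint {f : X →ₗ[R] Y} (hf : EssentialRange f)
    (g : Y →ₗ[R] Z) (h : ∀ x, g (f x) = 0 → f x = 0) : Function.Injective g := by
  rw [← LinearMap.ker_eq_bot]
  by_contra hne
  refine hf _ hne ((Submodule.eq_bot_iff _).2 ?_)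
  rintro _ ⟨⟨x, rfl⟩, hx⟩
  exact h x hx

/-- An endomorphism of a minimal injective coresolution lifting an automorphism is bijective. -/
lemma EssentialRange.bijective_of_comp_eq [Module.Injective R Z] {f : X →ₗ[R] Y} {g : Y →ₗ[R] Z}
    (hfg : LinearMap.ker g = LinearMap.range f) (hg : EssentialRange g)
    {a : X →ₗ[R] X} {b : Y →ₗ[R] Y} {c : Z →ₗ[R] Z} (hab : b ∘ₗ f = f ∘ₗ a)
    (hbc : c ∘ₗ g = g ∘ₗ b) (ha : Function.Surjective a) (hb : Function.Bijective b) :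
    Function.Bijective c := by
  have hc : Function.Injective c := by
    refine hg.injective_of_disjoint c fun y hy ↦ ?_
    have h1 : b y ∈ LinearMap.ker g := by
      rw [LinearMap.mem_ker, ← hy]
      exact (LinearMap.congr_fun hbc y).symm
    rw [hfg] at h1
    obtain ⟨x, hx⟩ := h1
    obtain ⟨x, rfl⟩ := ha x
    have h2 : b (f x) = b y := (LinearMap.congr_fun hab x).trans hx
    have h3 : y ∈ LinearMap.ker g := by
      rw [hfg, ← hb.1 h2]
      exact ⟨x, rfl⟩
    exact h3
  obtain ⟨r, hr⟩ := Module.Injective.out c hc LinearMap.id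
  have hri : Function.Injective r := by
    refine hg.injective_of_disjoint r fun y hy ↦ ?_
    obtain ⟨y, rfl⟩ := hb.2 y
    have h1 : c (g y) = g (b y) := LinearMap.congr_fun hbc y
    rw [← h1, hr] at hy
    rw [← h1, show g y = 0 from hy, map_zero]
  exact ⟨hc, fun z ↦ ⟨r z, hri (hr (r z))⟩⟩

lemma Module.Projective.of_bijective_comp [Module.Projective R Y] (j : X →ₗ[R] Y)
    (r : Y →ₗ[R] X) (h : Function.Bijective (r ∘ₗ j)) : Module.Projective R X := by
  let e := LinearEquiv.ofBijective _ h
  refine Module.Projective.of_split (j ∘ₗ e.symm.toLinearMap) r (LinearMap.ext fun x ↦ ?_)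
  exact e.apply_symm_apply x

/-- If the cokernel of an exact sequence `0 → R → J₀ → J₁ → J₂` with projective `Jᵢ` has
projective dimension at most two, then the first map splits. -/
lemma injective_self_of_modulePdLE_two {J₀ J₁ J₂ : Type} [AddCommGroup J₀] [Module R J₀]
    [AddCommGroup J₁] [Module R J₁] [AddCommGroup J₂] [Module R J₂] [Module.Injective R J₀]
    [Module.Projective R J₀] [Module.Projective R J₁] [Module.Projective R J₂]
    {ι : R →ₗ[R] J₀} {d₀ : J₀ →ₗ[R] J₁} {d₁ : J₁ →ₗ[R] J₂} (hι : Function.Injective ι)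
    (h₀ : LinearMap.ker d₀ = LinearMap.range ι) (h₁ : LinearMap.ker d₁ = LinearMap.range d₀)
    (h : ModulePdLE R 2 (J₂ ⧸ LinearMap.range d₁)) : Module.Injective R R := by
  rw [modulePdLE_quotient_iff, modulePdLE_range_iff, h₁, modulePdLE_zero_iff] at h
  obtain ⟨s, hs⟩ := Module.projective_lifting_property d₀.rangeRestrict LinearMap.id
    d₀.surjective_rangeRestrict
  have hs' (y : LinearMap.range d₀) : d₀ (s y) = y :=
    congrArg Subtype.val (LinearMap.congr_fun hs y)
  let e := LinearEquiv.ofInjective ι hι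
  let q : J₀ →ₗ[R] LinearMap.range ι :=
    (LinearMap.id - s ∘ₗ d₀.rangeRestrict).codRestrict _ fun x ↦ by
      rw [← h₀]
      simp [hs']
  refine Module.Injective.of_leftInverse ι (e.symm.toLinearMap ∘ₗ q) (LinearMap.ext fun x ↦ ?_)
  have hx : d₀.rangeRestrict (ι x) = 0 := by
    have h0 : ι x ∈ LinearMap.ker d₀ := h₀ ▸ ⟨x, rfl⟩
    exact Subtype.ext h0
  refine e.injective (Subtype.ext ?_)
  simp [q, hx, e]

variable (R) in
/-- `R` is a higher Auslander algebra of global dimension and dominant dimension `3`, where the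
dominant dimension is read off from minimal injective coresolutions. -/
def IsThreeAuslander : Prop :=
  ((∀ X Y : ModuleCat R, Subsingleton (((Ext ℤ (ModuleCat R) 4).obj (op X)).obj Y)) ∧
    (∃ X Y : ModuleCat R, Nontrivial (((Ext ℤ (ModuleCat R) 3).obj (op X)).obj Y))) ∧
  (∀ (I : ℕ → Type) [∀ n, AddCommGroup (I n)] [∀ n, Module R (I n)]
      (ε : R →ₗ[R] I 0) (d : ∀ n, I n →ₗ[R] I (n + 1)),
      (∀ n, Module.Injective R (I n)) →
      Function.Injective ε →
      LinearMap.ker (d 0) = LinearMap.range ε →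
      (∀ n, LinearMap.ker (d (n + 1)) = LinearMap.range (d n)) →
      EssentialRange ε →
      (∀ n, EssentialRange (d n)) →
      Module.Projective R (I 0) ∧ Module.Projective R (I 1) ∧
        Module.Projective R (I 2) ∧ ¬ Module.Projective R (I 3))

/-- A ring of global dimension at most `3` which is not self-injective and admits an exact sequence
`0 → R → E₀ → E₁ → E₂` with projective-injective `Eᵢ` is a higher
Auslander algebra. -/
theorem isThreeAuslander_of_exact {E₀ E₁ E₂ : Type} [AddCommGroup E₀] [Module R E₀]
    [AddCommGroup E₁] [Module R E₁] [AddCommGroup E₂] [Module R E₂] [Module.Injective R E₀]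
    [Module.Injective R E₁] [Module.Injective R E₂]
    [Module.Projective R E₀] [Module.Projective R E₁] [Module.Projective R E₂]
    {ι : R →ₗ[R] E₀} {f₀ : E₀ →ₗ[R] E₁} {f₁ : E₁ →ₗ[R] E₂} (hι : Function.Injective ι)
    (h₀ : LinearMap.ker f₀ = LinearMap.range ι) (h₁ : LinearMap.ker f₁ = LinearMap.range f₀)
    (hpd : ∀ (X : Type) [AddCommGroup X] [Module R X], ModulePdLE R 3 X)
    (hinj : ¬ Module.Injective R R) :
    IsThreeAuslander R := by
  refine ⟨⟨fun X ↦ (hasProjectiveDimensionLT_iff_subsingleton_Ext X 3).1 (hpd X), ?_⟩, ?_⟩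
  · by_contra! hcon
    refine hinj (injective_self_of_modulePdLE_two hι h₀ h₁ ?_)
    exact (hasProjectiveDimensionLT_iff_subsingleton_Ext _ 2).2 (hcon _)
  · intro I _ _ ε d hI hε hd₀ hd hess hessd
    have hιz : LinearMap.ker ι = LinearMap.range (0 : R →ₗ[R] R) := by
      rw [LinearMap.ker_eq_bot.2 hι, LinearMap.range_zero]
    have hεz : LinearMap.ker ε = LinearMap.range (0 : R →ₗ[R] R) := by
      rw [LinearMap.ker_eq_bot.2 hε, LinearMap.range_zero]
    have comp_zero {A B C : Type} [AddCommGroup A] [Module R A] [AddCommGroup B] [Module R B]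
        [AddCommGroup C] [Module R C] {f : A →ₗ[R] B} {g : B →ₗ[R] C}
        (h : LinearMap.ker g = LinearMap.range f) : g ∘ₗ f = 0 :=
      LinearMap.range_le_ker_iff.1 h.ge
    obtain ⟨j₀, hj₀⟩ := Module.Injective.exists_extension_of_exact hεz ι (by simp)
    obtain ⟨r₀, hr₀⟩ := Module.Injective.exists_extension_of_exact hιz ε (by simp)
    obtain ⟨j₁, hj₁⟩ := Module.Injective.exists_extension_of_exact hd₀ (f₀ ∘ₗ j₀)
      (by rw [LinearMap.comp_assoc, hj₀, comp_zero h₀])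
    obtain ⟨r₁, hr₁⟩ := Module.Injective.exists_extension_of_exact h₀ (d 0 ∘ₗ r₀)
      (by rw [LinearMap.comp_assoc, hr₀, comp_zero hd₀])
    obtain ⟨j₂, hj₂⟩ := Module.Injective.exists_extension_of_exact (hd 0) (f₁ ∘ₗ j₁)
      (by rw [LinearMap.comp_assoc, hj₁, ← LinearMap.comp_assoc, comp_zero h₁,
        LinearMap.zero_comp])
    obtain ⟨r₂, hr₂⟩ := Module.Injective.exists_extension_of_exact h₁ (d 1 ∘ₗ r₁)
      (by rw [LinearMap.comp_assoc, hr₁, ← LinearMap.comp_assoc, comp_zero (hd 0),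
        LinearMap.zero_comp])
    have hu₀ : (r₀ ∘ₗ j₀) ∘ₗ ε = ε ∘ₗ LinearMap.id := by
      rw [LinearMap.comp_assoc, hj₀, hr₀, LinearMap.comp_id]
    have hu₁ : (r₁ ∘ₗ j₁) ∘ₗ d 0 = d 0 ∘ₗ (r₀ ∘ₗ j₀) := by
      rw [LinearMap.comp_assoc, hj₁, ← LinearMap.comp_assoc, hr₁, LinearMap.comp_assoc]
    have hu₂ : (r₂ ∘ₗ j₂) ∘ₗ d 1 = d 1 ∘ₗ (r₁ ∘ₗ j₁) := by
      rw [LinearMap.comp_assoc, hj₂, ← LinearMap.comp_assoc, hr₂, LinearMap.comp_assoc]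
    have hb₀ := hess.bijective_of_comp_eq hεz (a := LinearMap.id) (by simp) hu₀
      Function.surjective_id Function.bijective_id
    have hb₁ := (hessd 0).bijective_of_comp_eq hd₀ hu₀ hu₁ Function.surjective_id hb₀
    have hb₂ := (hessd 1).bijective_of_comp_eq (hd 0) hu₁ hu₂ hb₀.2 hb₁
    have hp₀ := Module.Projective.of_bijective_comp _ _ hb₀
    have hp₁ := Module.Projective.of_bijective_comp _ _ hb₁
    have hp₂ := Module.Projective.of_bijective_comp _ _ hb₂
    refine ⟨hp₀, hp₁, hp₂, fun hp₃ ↦ hinj ?_⟩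
    refine injective_self_of_modulePdLE_two hε hd₀ (hd 0) ?_
    refine ModulePdLE.congr ((Submodule.quotEquivOfEq _ _ (hd 1).symm).trans
      (d 2).quotKerEquivRange).symm ?_
    rw [← modulePdLE_quotient_iff]
    exact hpd _

end InjectiveResolution

/-- The vertices of the quiver of `B = End_A(A ⊕ D(A))`: the indecomposable projective and the
indecomposable injective `A`-modules. -/
inductive BVertex : Type
  | P1 | P2 | P3 | I1 | I2 | I3
  deriving DecidableEq

/-- A basis of `B` consisting of paths in its quiver. -/
inductive BPath : Type
  | e1 | e2 | e3 | f1 | f2 | f3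
  | p1 | p3 | a | b | q1 | q3 | r11 | r13 | r31 | r33
  | p1a | p3b | aq1 | bq3 | s1 | s3 | t1 | t3
  | u1 | u3 | w
  deriving DecidableEq

/-- The trivial path at a vertex. -/
def BVertex.idem : BVertex → BPath
  | P1 => .e1 | P2 => .e2 | P3 => .e3 | I1 => .f1 | I2 => .f2 | I3 => .f3

namespace BPath

instance : Fintype BPath where
  elems := ⟨[e1, e2, e3, f1, f2, f3, p1, p3, a, b, q1, q3, r11, r13, r31, r33, p1a, p3b, aq1, bq3,
    s1, s3, t1, t3, u1, u3, w], by decide⟩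
  complete p := by cases p <;> decide

/-- The starting vertex of a path. -/
def src : BPath → BVertex
  | e1 | p1 | p1a | u1 => .P1
  | e2 | q1 | q3 | t1 | t3 | w => .P2
  | e3 | p3 | p3b | u3 => .P3
  | f1 | r11 | r13 | s1 => .I1
  | f2 | a | b | aq1 | bq3 => .I2
  | f3 | r31 | r33 | s3 => .I3

/-- The end vertex of a path. -/
def tgt : BPath → BVertex
  | e1 | r11 | r31 | t1 => .P1
  | e2 | a | b | p1a | p3b => .P2
  | e3 | r13 | r33 | t3 => .P3
  | f1 | q1 | aq1 | u1 => .I1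
  | f2 | p1 | p3 | s1 | s3 | w => .I2
  | f3 | q3 | bq3 | u3 => .I3

variable {k : Type} [Field k]

/-- The multiplication of `B` in path coordinates. -/
def mul (c d : BPath → k) : BPath → k
  | e1 => c e1 * d e1
  | e2 => c e2 * d e2
  | e3 => c e3 * d e3
  | f1 => c f1 * d f1
  | f2 => c f2 * d f2
  | f3 => c f3 * d f3
  | p1 => c e1 * d p1 + c p1 * d f2
  | p3 => c e3 * d p3 + c p3 * d f2
  | a => c f2 * d a + c a * d e2
  | b => c f2 * d b + c b * d e2
  | q1 => c e2 * d q1 + c q1 * d f1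
  | q3 => c e2 * d q3 + c q3 * d f3
  | r11 => c f1 * d r11 + c r11 * d e1
  | r13 => c f1 * d r13 + c r13 * d e3
  | r31 => c f3 * d r31 + c r31 * d e1
  | r33 => c f3 * d r33 + c r33 * d e3
  | p1a => c e1 * d p1a + c p1 * d a + c p1a * d e2
  | p3b => c e3 * d p3b + c p3 * d b + c p3b * d e2
  | aq1 => c f2 * d aq1 + c a * d q1 + c aq1 * d f1
  | bq3 => c f2 * d bq3 + c b * d q3 + c bq3 * d f3
  | s1 => c f1 * d s1 + c r11 * d p1 + c r13 * d p3 + c s1 * d f2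
  | s3 => c f3 * d s3 + c r31 * d p1 + c r33 * d p3 + c s3 * d f2
  | t1 => c e2 * d t1 + c q1 * d r11 + c q3 * d r31 + c t1 * d e1
  | t3 => c e2 * d t3 + c q1 * d r13 + c q3 * d r33 + c t3 * d e3
  | u1 => c e1 * d u1 + c p1 * d aq1 + c p1a * d q1 + c u1 * d f1
  | u3 => c e3 * d u3 + c p3 * d bq3 + c p3b * d q3 + c u3 * d f3
  | w => c e2 * d w + c q1 * d s1 + c q3 * d s3 + c t1 * d p1 + c t3 * d p3 + c w * d f2

lemma forall_iff {P : BPath → Prop} : (∀ p, P p) ↔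
    (P e1 ∧ P e2 ∧ P e3 ∧ P f1 ∧ P f2 ∧ P f3) ∧
    (P p1 ∧ P p3 ∧ P a ∧ P b ∧ P q1 ∧ P q3 ∧ P r11 ∧ P r13 ∧ P r31 ∧ P r33) ∧
    (P p1a ∧ P p3b ∧ P aq1 ∧ P bq3 ∧ P s1 ∧ P s3 ∧ P t1 ∧ P t3) ∧ P u1 ∧ P u3 ∧ P w :=
  ⟨fun h ↦ by simp [h], fun h p ↦ by cases p <;> simp [h]⟩

end BPath

/-- Coordinates on a `k`-algebra `R` identifying it with the path algebra of the quiver of `B`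
modulo its relations. -/
structure PathCoordinates (k R : Type) [Field k] [Ring R] [Algebra k R] extends
    R ≃ₗ[k] (BPath → k) where
  map_mul' (x y : R) : toFun (x * y) = BPath.mul (toFun x) (toFun y)

namespace PathCoordinates

open BPath BVertex

variable {k R : Type} [Field k] [Ring R] [Algebra k R] (φ : PathCoordinates k R)

/-- The coordinate of an element of `R` at a path. -/
def coord (p : BPath) : R →ₗ[k] k := LinearMap.proj p ∘ₗ φ.toLinearEquiv.toLinearMap

/-- The element of `R` with given coordinates. -/
def ofCoords (c : BPath → k) : R := φ.toLinearEquiv.symm c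

@[simp] lemma coord_ofCoords (c : BPath → k) (p : BPath) : φ.coord p (φ.ofCoords c) = c p := by
  simp [coord, ofCoords]

lemma ext {x y : R} (h : ∀ p, φ.coord p x = φ.coord p y) : x = y :=
  φ.toLinearEquiv.injective (funext h)

lemma coord_mul (x y : R) (p : BPath) :
    φ.coord p (x * y) = BPath.mul (φ.coord · x) (φ.coord · y) p :=
  congrFun (φ.map_mul' x y) p

/-- The element of `R` given by a path. -/
def path (p : BPath) : R := φ.ofCoords fun q ↦ if q = p then 1 else 0

@[simp] lemma coord_path (p q : BPath) : φ.coord q (φ.path p) = if q = p then 1 else 0 := by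
  simp [path]

lemma coord_one (p : BPath) : φ.coord p (1 : R) = if p = p.src.idem then 1 else 0 := by
  have h (x : R) : φ.ofCoords (fun p ↦ if p = p.src.idem then 1 else 0) * x = x :=
    φ.ext fun p ↦ by cases p <;> simp [coord_mul, BPath.mul, src, idem]
  rw [← h 1, mul_one, coord_ofCoords]

/-- The indecomposable projective `R`-module spanned by the paths ending at the vertex `v`. -/
def proj (v : BVertex) : Submodule R R where
  carrier := {x | ∀ p, p.tgt ≠ v → φ.coord p x = 0}
  zero_mem' := by simp
  add_mem' hx hy p hp := by simp [hx p hp, hy p hp]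
  smul_mem' r x hx p hp := by
    have hx' (p : BPath) (hp : p.tgt ≠ v) : φ.coord p x = 0 := hx p hp
    cases p <;> simp_all [coord_mul, BPath.mul, tgt]

lemma coord_eq_zero {v : BVertex} (x : φ.proj v) {p : BPath} (hp : p.tgt ≠ v) :
    φ.coord p (x : R) = 0 :=
  x.2 p hp

/-- The element of a projective module with given coordinates. -/
def projOfCoords (v : BVertex) (c : BPath → k) : φ.proj v :=
  ⟨φ.ofCoords fun p ↦ if p.tgt = v then c p else 0, fun p hp ↦ by simp [hp]⟩

@[simp] lemma coord_projOfCoords (v : BVertex) (c : BPath → k) (p : BPath) :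
    φ.coord p (φ.projOfCoords v c : R) = if p.tgt = v then c p else 0 := by
  simp [projOfCoords]

/-- A path as an element of a projective module. -/
def projPath (v : BVertex) (p : BPath) : φ.proj v :=
  φ.projOfCoords v fun q ↦ if q = p then 1 else 0

@[simp] lemma coord_projPath (v : BVertex) (p q : BPath) :
    φ.coord q (φ.projPath v p : R) = if q.tgt = v then if q = p then 1 else 0 else 0 := by
  simp [projPath]

lemma coord_smul {v : BVertex} (x : R) (y : φ.proj v) (p : BPath) :
    φ.coord p ((x • y : φ.proj v) : R) = BPath.mul (φ.coord · x) (φ.coord · y) p :=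
  φ.coord_mul x y p

lemma proj_eq_iff {v : BVertex} {x y : φ.proj v} :
    x = y ↔ ∀ p, p.tgt = v → φ.coord p (x : R) = φ.coord p (y : R) := by
  refine ⟨fun h p _ ↦ h ▸ rfl, fun h ↦ Subtype.ext (φ.ext fun p ↦ ?_)⟩
  by_cases hp : p.tgt = v
  · exact h p hp
  · rw [φ.coord_eq_zero x hp, φ.coord_eq_zero y hp]

lemma mul_idem {v : BVertex} (x : φ.proj v) : (x : R) * φ.path v.idem = x := by
  refine φ.ext fun p ↦ ?_
  by_cases hp : p.tgt = v
  · subst hp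
    rw [coord_mul]
    cases p <;> simp [BPath.mul, idem, tgt]
  · rw [φ.coord_eq_zero x hp]
    have h := (φ.proj v).smul_mem (x : R) (show φ.path v.idem ∈ φ.proj v from fun q hq ↦ by
      rw [coord_path, if_neg (by rintro rfl; cases v <;> exact hq rfl)])
    exact h p hp

instance (v : BVertex) : Module.Projective R (φ.proj v) := by
  let j : R →ₗ[R] φ.proj v := LinearMap.toSpanSingleton R _ (φ.projPath v v.idem)
  refine Module.Projective.of_split (φ.proj v).subtype j (LinearMap.ext fun x ↦ Subtype.ext ?_)
  refine Eq.trans ?_ (φ.mul_idem x)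
  change (x : R) * _ = _
  congr 1
  refine φ.ext fun p ↦ ?_
  rw [coord_projPath, coord_path]
  cases p <;> cases v <;> simp [tgt, idem]

/-- Right multiplication by an element of a module. -/
def toModule {N : Type} [AddCommGroup N] [Module R N] (v : BVertex) (n : N) : φ.proj v →ₗ[R] N :=
  LinearMap.toSpanSingleton R N n ∘ₗ (φ.proj v).subtype

@[simp] lemma toModule_apply {N : Type} [AddCommGroup N] [Module R N] (v : BVertex) (n : N)
    (x : φ.proj v) : φ.toModule v n x = (x : R) • n := rfl

end PathCoordinates

/-- A module over a `k`-algebra that carries a nondegenerate linear form representing all the linear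
forms `r ↦ μ (e * r)` is injective. -/
lemma Module.Injective.of_linearForm {k R N : Type} [Field k] [Ring R] [Algebra k R]
    [AddCommGroup N] [Module R N] [Module k N] [IsScalarTower k R N] (t : N →ₗ[k] k) (e : R)
    (he : ∀ n, t (e • n) = t n) (ht : ∀ n, (∀ r : R, t (r • n) = 0) → n = 0)
    (h : ∀ μ : R →ₗ[k] k, ∃ n, ∀ r : R, t (r • n) = μ (e * r)) : Module.Injective R N where
  out X Y _ _ _ _ f hf g := by
    let _ : Module k X := Module.compHom X (algebraMap k R)
    let _ : Module k Y := Module.compHom Y (algebraMap k R)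
    have hX (c : k) (x : X) : c • x = algebraMap k R c • x := rfl
    have hY (c : k) (y : Y) : c • y = algebraMap k R c • y := rfl
    have hN (c : k) (n : N) : c • n = algebraMap k R c • n := (algebraMap_smul R c n).symm
    let f' : X →ₗ[k] Y := { f with map_smul' c x := by simp [hX, hY] }
    let g' : X →ₗ[k] N := { g with map_smul' c x := (g.map_smul _ x).trans (hN c _).symm }
    obtain ⟨s, hs⟩ := f'.exists_leftInverse_of_injective (LinearMap.ker_eq_bot.2 hf)
    let H : Y →ₗ[k] k := t ∘ₗ g' ∘ₗ s
    have hH (x : X) : H (f x) = t (g x) := by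
      change t (g (s (f' x))) = _
      rw [show s (f' x) = x from LinearMap.congr_fun hs x]
    have hex (y : Y) : ∃ n, ∀ r : R, t (r • n) = H ((e * r) • y) :=
      h (H ∘ₗ { toFun r := r • y, map_add' := fun r s ↦ add_smul r s y,
                map_smul' := fun c r ↦ by simp [hY, Algebra.smul_def, mul_smul] })
    choose G hG using hex
    have hG' {y : Y} {n : N} (hn : ∀ r : R, t (r • n) = H ((e * r) • y)) : G y = n := by
      rw [← sub_eq_zero]
      exact ht _ fun r ↦ by rw [smul_sub, map_sub, hG, hn, sub_self]
    refine ⟨{ toFun := G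
              map_add' := fun y z ↦ hG' fun r ↦ ?_
              map_smul' := fun s y ↦ hG' fun r ↦ ?_ },
      fun x ↦ hG' fun r ↦ ?_⟩
    · rw [smul_add, map_add, hG, hG, smul_add, map_add]
    · rw [RingHom.id_apply, smul_smul, hG, smul_smul, mul_assoc]
    · rw [← map_smul f, hH, map_smul g, mul_smul, he]

namespace PathCoordinates

open BPath BVertex

variable {k R : Type} [Field k] [Ring R] [Algebra k R] (φ : PathCoordinates k R)

/-- A linear form on a projective module. -/
def projForm (v : BVertex) (p : BPath) : φ.proj v →ₗ[k] k :=
  φ.coord p ∘ₗ ((φ.proj v).subtype.restrictScalars k)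

@[simp] lemma projForm_apply (v : BVertex) (p : BPath) (x : φ.proj v) :
    φ.projForm v p x = φ.coord p x := rfl

instance : Module.Injective R (φ.proj I1) := by
  refine .of_linearForm (φ.projForm I1 u1) (φ.path e1) (fun n ↦ ?_) (fun n hn ↦ ?_) fun μ ↦ ?_
  · simp [coord_mul, BPath.mul]
  · have h1 := hn (φ.path e1)
    have h2 := hn (φ.path p1)
    have h3 := hn (φ.path p1a)
    have h4 := hn (φ.path u1)
    simp only [projForm_apply, coord_smul, BPath.mul, coord_path] at h1 h2 h3 h4
    refine φ.proj_eq_iff.2 fun p hp ↦ ?_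
    cases p <;> simp_all [tgt]
  · refine ⟨φ.projOfCoords I1 fun
      | u1 => μ (φ.path e1) | aq1 => μ (φ.path p1) | q1 => μ (φ.path p1a) | f1 => μ (φ.path u1)
      | _ => 0, fun r ↦ ?_⟩
    have h : φ.path e1 * r = φ.coord e1 r • φ.path e1 + φ.coord p1 r • φ.path p1 +
        φ.coord p1a r • φ.path p1a + φ.coord u1 r • φ.path u1 :=
      φ.ext fun p ↦ by cases p <;> simp [coord_mul, BPath.mul]
    simp [h, coord_mul, BPath.mul, tgt]

instance : Module.Injective R (φ.proj I3) := by
  refine .of_linearForm (φ.projForm I3 u3) (φ.path e3) (fun n ↦ ?_) (fun n hn ↦ ?_) fun μ ↦ ?_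
  · simp [coord_mul, BPath.mul]
  · have h1 := hn (φ.path e3)
    have h2 := hn (φ.path p3)
    have h3 := hn (φ.path p3b)
    have h4 := hn (φ.path u3)
    simp only [projForm_apply, coord_smul, BPath.mul, coord_path] at h1 h2 h3 h4
    refine φ.proj_eq_iff.2 fun p hp ↦ ?_
    cases p <;> simp_all [tgt]
  · refine ⟨φ.projOfCoords I3 fun
      | u3 => μ (φ.path e3) | bq3 => μ (φ.path p3) | q3 => μ (φ.path p3b) | f3 => μ (φ.path u3)
      | _ => 0, fun r ↦ ?_⟩
    have h : φ.path e3 * r = φ.coord e3 r • φ.path e3 + φ.coord p3 r • φ.path p3 +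
        φ.coord p3b r • φ.path p3b + φ.coord u3 r • φ.path u3 :=
      φ.ext fun p ↦ by cases p <;> simp [coord_mul, BPath.mul]
    simp [h, coord_mul, BPath.mul, tgt]

instance : Module.Injective R (φ.proj I2) := by
  refine .of_linearForm (φ.projForm I2 w) (φ.path e2) (fun n ↦ ?_) (fun n hn ↦ ?_) fun μ ↦ ?_
  · simp [coord_mul, BPath.mul]
  · have h1 := hn (φ.path e2)
    have h2 := hn (φ.path q1)
    have h3 := hn (φ.path q3)
    have h4 := hn (φ.path t1)
    have h5 := hn (φ.path t3)
    have h6 := hn (φ.path w)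
    simp only [projForm_apply, coord_smul, BPath.mul, coord_path] at h1 h2 h3 h4 h5 h6
    refine φ.proj_eq_iff.2 fun p hp ↦ ?_
    cases p <;> simp_all [tgt]
  · refine ⟨φ.projOfCoords I2 fun
      | w => μ (φ.path e2) | s1 => μ (φ.path q1) | s3 => μ (φ.path q3) | p1 => μ (φ.path t1)
      | p3 => μ (φ.path t3) | f2 => μ (φ.path w) | _ => 0, fun r ↦ ?_⟩
    have h : φ.path e2 * r = φ.coord e2 r • φ.path e2 + φ.coord q1 r • φ.path q1 +
        φ.coord q3 r • φ.path q3 + φ.coord t1 r • φ.path t1 + φ.coord t3 r • φ.path t3 +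
        φ.coord w r • φ.path w :=
      φ.ext fun p ↦ by cases p <;> simp [coord_mul, BPath.mul]
    simp [h, coord_mul, BPath.mul, tgt]

end PathCoordinates

section

variable {R X Y Z : Type} [Ring R] [AddCommGroup X] [Module R X] [AddCommGroup Y] [Module R Y]
  [AddCommGroup Z] [Module R Z]

lemma ModulePdLE.range_of_injective [Module.Projective R X] {f : X →ₗ[R] Y}
    (hf : Function.Injective f) : ModulePdLE R 0 (LinearMap.range f) :=
  (modulePdLE_zero_iff.2 ‹_›).congr (LinearEquiv.ofInjective f hf)

lemma ModulePdLE.range_of_exact [Module.Projective R Y] {n : ℕ} {f : X →ₗ[R] Y} {g : Y →ₗ[R] Z}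
    (hfg : ∀ y, g y = 0 ↔ ∃ x, f x = y) (h : ModulePdLE R n (LinearMap.range f)) :
    ModulePdLE R (n + 1) (LinearMap.range g) := by
  rwa [modulePdLE_range_iff, show LinearMap.ker g = LinearMap.range f from Submodule.ext hfg]

end

namespace PathCoordinates

open BPath BVertex

variable {k R : Type} [Field k] [Ring R] [Algebra k R] (φ : PathCoordinates k R)

/-- The radical of a projective module. -/
def rad (v : BVertex) : Submodule R (φ.proj v) where
  carrier := {x | φ.coord v.idem (x : R) = 0}
  zero_mem' := by simp
  add_mem' {x y} hx hy := by
    rw [Set.mem_ofPred_eq] at *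
    simp [hx, hy]
  smul_mem' r x hx := by
    rw [Set.mem_ofPred_eq] at *
    cases v <;> simp_all [coord_mul, BPath.mul, idem]

lemma mem_rad {v : BVertex} {x : φ.proj v} : x ∈ φ.rad v ↔ φ.coord v.idem (x : R) = 0 := Iff.rfl

/-- The map from `proj P2` to `proj I1 × proj I3` with components `q1` and `-q3`. -/
def syzygyMap : φ.proj P2 →ₗ[R] φ.proj I1 × φ.proj I3 :=
  (φ.toModule P2 (φ.projPath I1 q1)).prod (-φ.toModule P2 (φ.projPath I3 q3))

lemma syzygyMap_injective : Function.Injective φ.syzygyMap := by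
  refine (injective_iff_map_eq_zero _).2 fun x hx ↦ ?_
  simp [syzygyMap, proj_eq_iff, forall_iff, tgt, coord_mul, BPath.mul] at hx ⊢
  grind

lemma rad_P1 : ModulePdLE R 1 (φ.rad P1) := by
  let g := (φ.toModule I1 (φ.projPath P1 r11)).coprod (φ.toModule I3 (φ.projPath P1 r31))
  have h : φ.rad P1 = LinearMap.range g := by
    refine Submodule.ext fun y ↦ ⟨fun hy ↦ ?_, ?_⟩
    · rw [mem_rad, idem] at hy
      refine ⟨(φ.projOfCoords I1 fun | f1 => φ.coord r11 y | q1 => φ.coord t1 y | _ => 0,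
        φ.projOfCoords I3 fun | f3 => φ.coord r31 y | _ => 0), ?_⟩
      simp [g, proj_eq_iff, forall_iff, tgt, coord_mul, BPath.mul, hy]
    · rintro ⟨x, rfl⟩
      simp [g, mem_rad, idem, coord_mul, BPath.mul, tgt]
  rw [h]
  refine .range_of_exact (f := φ.syzygyMap) (fun y ↦ ⟨fun hy ↦ ⟨φ.projOfCoords P2 fun
      | e2 => φ.coord q1 y.1 | a => φ.coord aq1 y.1 | p1a => φ.coord u1 y.1 | b => -φ.coord bq3 y.2
      | p3b => -φ.coord u3 y.2 | _ => 0, ?_⟩, ?_⟩)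
    (.range_of_injective φ.syzygyMap_injective)
  · simp [g, syzygyMap, Prod.ext_iff, proj_eq_iff, forall_iff, tgt, coord_mul, BPath.mul]
      at hy ⊢
    grind
  · rintro ⟨x, rfl⟩
    simp [g, syzygyMap, proj_eq_iff, tgt, coord_mul, BPath.mul]

lemma rad_P3 : ModulePdLE R 1 (φ.rad P3) := by
  let g := (φ.toModule I1 (φ.projPath P3 r13)).coprod (φ.toModule I3 (φ.projPath P3 r33))
  have h : φ.rad P3 = LinearMap.range g := by
    refine Submodule.ext fun y ↦ ⟨fun hy ↦ ?_, ?_⟩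
    · rw [mem_rad, idem] at hy
      refine ⟨(φ.projOfCoords I1 fun | f1 => φ.coord r13 y | q1 => φ.coord t3 y | _ => 0,
        φ.projOfCoords I3 fun | f3 => φ.coord r33 y | _ => 0), ?_⟩
      simp [g, proj_eq_iff, forall_iff, tgt, coord_mul, BPath.mul, hy]
    · rintro ⟨x, rfl⟩
      simp [g, mem_rad, idem, coord_mul, BPath.mul, tgt]
  rw [h]
  refine .range_of_exact (f := φ.syzygyMap) (fun y ↦ ⟨fun hy ↦ ⟨φ.projOfCoords P2 fun
      | e2 => φ.coord q1 y.1 | a => φ.coord aq1 y.1 | p1a => φ.coord u1 y.1 | b => -φ.coord bq3 y.2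
      | p3b => -φ.coord u3 y.2 | _ => 0, ?_⟩, ?_⟩)
    (.range_of_injective φ.syzygyMap_injective)
  · simp [g, syzygyMap, Prod.ext_iff, proj_eq_iff, forall_iff, tgt, coord_mul, BPath.mul]
      at hy ⊢
    grind
  · rintro ⟨x, rfl⟩
    simp [g, syzygyMap, proj_eq_iff, tgt, coord_mul, BPath.mul]

lemma rad_P2 : ModulePdLE R 1 (φ.rad P2) := by
  let f := (φ.toModule P3 (φ.projPath I2 p3)).prodMap (φ.toModule P1 (φ.projPath I2 p1))
  have hf : Function.Injective f := by
    refine (injective_iff_map_eq_zero _).2 fun x hx ↦ ?_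
    simp [f, Prod.ext_iff, proj_eq_iff, forall_iff, tgt, coord_mul, BPath.mul] at hx ⊢
    grind
  let g := (φ.toModule I2 (φ.projPath P2 a)).coprod (φ.toModule I2 (φ.projPath P2 b))
  have h : φ.rad P2 = LinearMap.range g := by
    refine Submodule.ext fun y ↦ ⟨fun hy ↦ ?_, ?_⟩
    · rw [mem_rad, idem] at hy
      refine ⟨(φ.projOfCoords I2 fun | f2 => φ.coord a y | p1 => φ.coord p1a y | _ => 0,
        φ.projOfCoords I2 fun | f2 => φ.coord b y | p3 => φ.coord p3b y | _ => 0), ?_⟩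
      simp [g, proj_eq_iff, forall_iff, tgt, coord_mul, BPath.mul, hy]
    · rintro ⟨x, rfl⟩
      simp [g, mem_rad, idem, coord_mul, BPath.mul, tgt]
  rw [h]
  refine .range_of_exact (f := f) (fun y ↦ ⟨fun hy ↦ ⟨(φ.projOfCoords P3 fun
      | e3 => φ.coord p3 y.1 | r13 => φ.coord s1 y.1 | r33 => φ.coord s3 y.1 | t3 => φ.coord w y.1
      | _ => 0,
      φ.projOfCoords P1 fun
          | e1 => φ.coord p1 y.2 | r11 => φ.coord s1 y.2 | r31 => φ.coord s3 y.2
          | t1 => φ.coord w y.2 | _ => 0), ?_⟩, ?_⟩)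
    (.range_of_injective hf)
  · simp [g, f, Prod.ext_iff, proj_eq_iff, forall_iff, tgt, coord_mul, BPath.mul]
      at hy ⊢
    grind
  · rintro ⟨x, rfl⟩
    simp [g, f, proj_eq_iff, forall_iff, tgt, coord_mul, BPath.mul]

lemma rad_I1 : ModulePdLE R 2 (φ.rad I1) := by
  let f := φ.toModule I2 (φ.projPath P2 b)
  let f' := φ.toModule P1 (φ.projPath I2 p1)
  have hf : Function.Injective f' := by
    refine (injective_iff_map_eq_zero _).2 fun x hx ↦ ?_
    simp [f', proj_eq_iff, forall_iff, tgt, coord_mul, BPath.mul] at hx ⊢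
    grind
  let g := φ.toModule P2 (φ.projPath I1 q1)
  have h : φ.rad I1 = LinearMap.range g := by
    refine Submodule.ext fun y ↦ ⟨fun hy ↦ ?_, ?_⟩
    · rw [mem_rad, idem] at hy
      refine ⟨φ.projOfCoords P2 fun
          | e2 => φ.coord q1 y | a => φ.coord aq1 y | p1a => φ.coord u1 y | _ => 0, ?_⟩
      simp [g, proj_eq_iff, forall_iff, tgt, coord_mul, BPath.mul, hy]
    · rintro ⟨x, rfl⟩
      simp [g, mem_rad, idem, coord_mul, BPath.mul, tgt]
  rw [h]
  refine .range_of_exact (f := f) (fun y ↦ ⟨fun hy ↦ ⟨φ.projOfCoords I2 fun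
      | f2 => φ.coord b y | p3 => φ.coord p3b y | _ => 0, ?_⟩, ?_⟩)
    (.range_of_exact (f := f') (fun y ↦ ⟨fun hy ↦ ⟨φ.projOfCoords P1 fun
        | e1 => φ.coord p1 y | r11 => φ.coord s1 y | r31 => φ.coord s3 y | t1 => φ.coord w y
        | _ => 0, ?_⟩, ?_⟩)
      (.range_of_injective hf))
  · simp [g, f, proj_eq_iff, forall_iff, tgt, coord_mul, BPath.mul]
      at hy ⊢
    grind
  · rintro ⟨x, rfl⟩
    simp [g, f, proj_eq_iff, forall_iff, tgt, coord_mul, BPath.mul]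
  · simp [f, f', proj_eq_iff, forall_iff, tgt, coord_mul, BPath.mul] at hy ⊢
    grind
  · rintro ⟨x, rfl⟩
    simp [f, f', proj_eq_iff, forall_iff, tgt, coord_mul, BPath.mul]

lemma rad_I3 : ModulePdLE R 2 (φ.rad I3) := by
  let f := φ.toModule I2 (φ.projPath P2 a)
  let f' := φ.toModule P3 (φ.projPath I2 p3)
  have hf : Function.Injective f' := by
    refine (injective_iff_map_eq_zero _).2 fun x hx ↦ ?_
    simp [f', proj_eq_iff, forall_iff, tgt, coord_mul, BPath.mul] at hx ⊢
    grind
  let g := φ.toModule P2 (φ.projPath I3 q3)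
  have h : φ.rad I3 = LinearMap.range g := by
    refine Submodule.ext fun y ↦ ⟨fun hy ↦ ?_, ?_⟩
    · rw [mem_rad, idem] at hy
      refine ⟨φ.projOfCoords P2 fun
          | e2 => φ.coord q3 y | b => φ.coord bq3 y | p3b => φ.coord u3 y | _ => 0, ?_⟩
      simp [g, proj_eq_iff, forall_iff, tgt, coord_mul, BPath.mul, hy]
    · rintro ⟨x, rfl⟩
      simp [g, mem_rad, idem, coord_mul, BPath.mul, tgt]
  rw [h]
  refine .range_of_exact (f := f) (fun y ↦ ⟨fun hy ↦ ⟨φ.projOfCoords I2 fun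
      | f2 => φ.coord a y | p1 => φ.coord p1a y | _ => 0, ?_⟩, ?_⟩)
    (.range_of_exact (f := f') (fun y ↦ ⟨fun hy ↦ ⟨φ.projOfCoords P3 fun
        | e3 => φ.coord p3 y | r13 => φ.coord s1 y | r33 => φ.coord s3 y | t3 => φ.coord w y
        | _ => 0, ?_⟩, ?_⟩)
      (.range_of_injective hf))
  · simp [g, f, proj_eq_iff, forall_iff, tgt, coord_mul, BPath.mul]
      at hy ⊢
    grind
  · rintro ⟨x, rfl⟩
    simp [g, f, proj_eq_iff, forall_iff, tgt, coord_mul, BPath.mul]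
  · simp [f, f', proj_eq_iff, forall_iff, tgt, coord_mul, BPath.mul] at hy ⊢
    grind
  · rintro ⟨x, rfl⟩
    simp [f, f', proj_eq_iff, forall_iff, tgt, coord_mul, BPath.mul]

lemma rad_I2 : ModulePdLE R 2 (φ.rad I2) := by
  let f := ((φ.toModule I1 (φ.projPath P1 r11)).coprod (φ.toModule I3 (φ.projPath P1 r31))).prod
    (-(φ.toModule I1 (φ.projPath P3 r13)).coprod (φ.toModule I3 (φ.projPath P3 r33)))
  let g := (φ.toModule P1 (φ.projPath I2 p1)).coprod (φ.toModule P3 (φ.projPath I2 p3))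
  have h : φ.rad I2 = LinearMap.range g := by
    refine Submodule.ext fun y ↦ ⟨fun hy ↦ ?_, ?_⟩
    · rw [mem_rad, idem] at hy
      refine ⟨(φ.projOfCoords P1 fun
          | e1 => φ.coord p1 y | r11 => φ.coord s1 y | r31 => φ.coord s3 y | t1 => φ.coord w y
          | _ => 0,
        φ.projOfCoords P3 fun | e3 => φ.coord p3 y | _ => 0), ?_⟩
      simp [g, proj_eq_iff, forall_iff, tgt, coord_mul, BPath.mul, hy]
    · rintro ⟨x, rfl⟩
      simp [g, mem_rad, idem, coord_mul, BPath.mul, tgt]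
  rw [h]
  refine .range_of_exact (f := f) (fun y ↦ ⟨fun hy ↦ ⟨(φ.projOfCoords I1 fun
      | f1 => φ.coord r11 y.1 | q1 => φ.coord t1 y.1 | _ => 0,
      φ.projOfCoords I3 fun | f3 => φ.coord r31 y.1 | _ => 0), ?_⟩, ?_⟩)
    (.range_of_exact (f := φ.syzygyMap) (fun y ↦ ⟨fun hy ↦ ⟨φ.projOfCoords P2 fun
        | e2 => φ.coord q1 y.1 | a => φ.coord aq1 y.1 | p1a => φ.coord u1 y.1
        | b => -φ.coord bq3 y.2 | p3b => -φ.coord u3 y.2 | _ => 0, ?_⟩, ?_⟩)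
      (.range_of_injective φ.syzygyMap_injective))
  · simp [g, f, Prod.ext_iff, proj_eq_iff, forall_iff, tgt, coord_mul, BPath.mul]
      at hy ⊢
    grind
  · rintro ⟨x, rfl⟩
    simp [g, f, proj_eq_iff, forall_iff, tgt, coord_mul, BPath.mul]
  · simp [f, syzygyMap, Prod.ext_iff, proj_eq_iff, forall_iff, tgt, coord_mul, BPath.mul] at hy ⊢
    grind
  · rintro ⟨x, rfl⟩
    simp [f, syzygyMap, proj_eq_iff, tgt, coord_mul, BPath.mul]

lemma coord_idem_mul (v : BVertex) (x y : R) :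
    φ.coord v.idem (x * y) = φ.coord v.idem x * φ.coord v.idem y := by
  rw [coord_mul]
  cases v <;> rfl

lemma coord_idem_one (v : BVertex) : φ.coord v.idem (1 : R) = 1 := by
  rw [coord_one]
  cases v <;> rfl

/-- The one-dimensional character of `R` at a vertex. -/
def character (v : BVertex) : R →+* k where
  toFun := φ.coord v.idem
  map_one' := φ.coord_idem_one v
  map_mul' := φ.coord_idem_mul v
  map_zero' := map_zero _
  map_add' := map_add _

lemma rad_modulePdLE (v : BVertex) : ModulePdLE R 2 (φ.rad v) := by
  cases v
  · exact φ.rad_P1.mono (by decide)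
  · exact φ.rad_P2.mono (by decide)
  · exact φ.rad_P3.mono (by decide)
  · exact φ.rad_I1
  · exact φ.rad_I2
  · exact φ.rad_I3

lemma modulePdLE_of_smul_eq (v : BVertex) {X : Type} [AddCommGroup X] [Module R X]
    (h : ∀ (r : R) (x : X), r • x = algebraMap k R (φ.coord v.idem r) • x) :
    ModulePdLE R 3 X := by
  classical
  let _ : Module k X := Module.compHom X (algebraMap k R)
  have hX (c : k) (x : X) : c • x = algebraMap k R c • x := rfl
  let _ : Module R k := Module.compHom k (φ.character v)
  have hk (r : R) (c : k) : r • c = φ.coord v.idem r * c := rfl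
  let g : φ.proj v →ₗ[R] k :=
    { toFun x := φ.coord v.idem x
      map_add' x y := by simp
      map_smul' r x := φ.coord_idem_mul v r x }
  have hg : Function.Surjective g := fun c ↦ by
    refine ⟨φ.projOfCoords v fun _ ↦ c, ?_⟩
    change φ.coord v.idem (φ.projOfCoords v fun _ ↦ c : R) = c
    cases v <;> simp [tgt, idem]
  have hkpd : ModulePdLE R 3 k :=
    (modulePdLE_succ_iff (f := (φ.rad v).subtype) (g := g) (Submodule.injective_subtype _)
      (LinearMap.exact_iff.2 (by rw [Submodule.range_subtype]; rfl)) hg).2 (φ.rad_modulePdLE v)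
  let b := Module.Basis.ofVectorSpace k X
  have hb := ModulePdLE.dfinsupp (fun _ : Module.Basis.ofVectorSpaceIndex k X ↦ k) fun _ ↦ hkpd
  refine hb.congr ((finsuppLequivDFinsupp R).symm.trans
    { b.repr.symm with map_smul' r x := ?_ })
  have hr : r • x = φ.coord v.idem r • x := by
    ext i
    simp [hk]
  simp [hr, h r, ← hX]

/-- A numbering of the paths refining the order by length. -/
def _root_.BPath.rank : BPath → ℕ
  | e1 => 0 | e2 => 1 | e3 => 2 | f1 => 3 | f2 => 4 | f3 => 5
  | p1 => 6 | p3 => 7 | a => 8 | b => 9 | q1 => 10 | q3 => 11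
  | r11 => 12 | r13 => 13 | r31 => 14 | r33 => 15
  | p1a => 16 | p3b => 17 | aq1 => 18 | bq3 => 19 | s1 => 20 | s3 => 21 | t1 => 22 | t3 => 23
  | u1 => 24 | u3 => 25 | w => 26

lemma coord_mul_path (r : R) (p q : BPath) (h : q.rank ≤ p.rank) :
    φ.coord q (r * φ.path p) = if q = p then φ.coord p.src.idem r else 0 := by
  rw [coord_mul]
  cases p <;> cases q <;> first | (simp [rank] at h; done) | simp [BPath.mul, src, idem]

lemma _root_.BPath.rank_injective : Function.Injective rank := by
  unfold Function.Injective
  decide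

lemma eq_sum_path (r : R) : r = ∑ p, φ.coord p r • φ.path p :=
  φ.ext fun q ↦ by simp

lemma smul_eq_zero_of_rank {X : Type} [AddCommGroup X] [Module R X] {d : ℕ}
    (h : ∀ p, d ≤ rank p → ∀ x : X, φ.path p • x = 0) {r : R}
    (hr : ∀ p, rank p < d → φ.coord p r = 0) (x : X) : r • x = 0 := by
  rw [φ.eq_sum_path r, Finset.sum_smul]
  refine Finset.sum_eq_zero fun p _ ↦ ?_
  obtain hp | hp := lt_or_ge p.rank d
  · rw [hr p hp, zero_smul, zero_smul]
  · rw [Algebra.smul_def, mul_smul, h p hp, smul_zero]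

/-- Every module has a filtration by one-dimensional modules. -/
lemma modulePdLE_of_rank (d : ℕ) (X : Type) [AddCommGroup X] [Module R X]
    (h : ∀ p, d ≤ rank p → ∀ x : X, φ.path p • x = 0) : ModulePdLE R 3 X := by
  induction d generalizing X with
  | zero =>
    have : Subsingleton X := ⟨fun x y ↦ by
      have hz (x : X) : x = 0 := by
        rw [← one_smul R x]
        exact φ.smul_eq_zero_of_rank h (by simp) x
      rw [hz x, hz y]⟩
    exact (modulePdLE_zero_iff.2 inferInstance).mono (Nat.zero_le 3)
  | succ d ih =>
    by_cases hd : ∃ p : BPath, p.rank = d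
    · obtain ⟨p, rfl⟩ := hd
      have key (r : R) (x : X) : r • φ.path p • x =
          algebraMap k R (φ.coord p.src.idem r) • φ.path p • x := by
        rw [smul_smul, smul_smul, ← sub_eq_zero, ← sub_smul]
        refine φ.smul_eq_zero_of_rank h (fun q hq ↦ ?_) x
        rw [map_sub, φ.coord_mul_path r p q (by lia), ← Algebra.smul_def, map_smul, coord_path]
        split_ifs <;> simp
      let N : Submodule R X :=
        { carrier := {n | ∃ x, φ.path p • x = n}
          zero_mem' := ⟨0, smul_zero _⟩
          add_mem' := by
            rintro _ _ ⟨x, rfl⟩ ⟨y, rfl⟩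
            exact ⟨x + y, smul_add _ _ _⟩
          smul_mem' := by
            rintro r _ ⟨x, rfl⟩
            refine ⟨algebraMap k R (φ.coord p.src.idem r) • x, ?_⟩
            rw [key, smul_smul, smul_smul, Algebra.commutes] }
      refine .of_submodule N (φ.modulePdLE_of_smul_eq p.src ?_) (ih _ fun q hq x ↦ ?_)
      · rintro r ⟨_, x, rfl⟩
        exact Subtype.ext (key r x)
      · obtain ⟨x, rfl⟩ := N.mkQ_surjective x
        rw [← map_smul, Submodule.mkQ_apply, Submodule.Quotient.mk_eq_zero]
        obtain hq | hq := hq.eq_or_lt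
        · rw [← rank_injective hq]
          exact ⟨x, rfl⟩
        · rw [h q hq]
          exact N.zero_mem
    · refine ih X fun p hp ↦ h p (lt_of_le_of_ne hp ?_)
      rintro rfl
      exact hd ⟨p, rfl⟩

lemma modulePdLE_three (φ : PathCoordinates k R) (X : Type) [AddCommGroup X] [Module R X] :
    ModulePdLE R 3 X :=
  φ.modulePdLE_of_rank 27 X fun p hp ↦ absurd hp (by cases p <;> decide)

lemma not_injective (φ : PathCoordinates k R) : ¬ Module.Injective R R := by
  intro hR
  let f := φ.toModule P1 (φ.projPath I2 p1)
  have hf : Function.Injective f := by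
    refine (injective_iff_map_eq_zero _).2 fun x hx ↦ ?_
    simp [f, proj_eq_iff, forall_iff, tgt, coord_mul, BPath.mul] at hx ⊢
    grind
  obtain ⟨g, hg⟩ := Module.Injective.out f hf (φ.proj P1).subtype
  have h1 := congrArg (φ.coord e1) (hg (φ.projPath P1 e1))
  have h2 : f (φ.projPath P1 e1) = φ.path p1 • φ.projPath I2 f2 := by
    simp [f, proj_eq_iff, tgt, coord_mul, BPath.mul]
  rw [h2, map_smul, smul_eq_mul, coord_mul] at h1
  simp [BPath.mul, tgt] at h1

end PathCoordinates

instance Module.Injective.prod {R X Y : Type} [Ring R] [AddCommGroup X] [Module R X]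
    [AddCommGroup Y] [Module R Y] [Module.Injective R X] [Module.Injective R Y] :
    Module.Injective R (X × Y) where
  out A B _ _ _ _ f hf g := by
    obtain ⟨h₁, hh₁⟩ := Module.Injective.out f hf (LinearMap.fst R X Y ∘ₗ g)
    obtain ⟨h₂, hh₂⟩ := Module.Injective.out f hf (LinearMap.snd R X Y ∘ₗ g)
    exact ⟨h₁.prod h₂, fun x ↦ Prod.ext (hh₁ x) (hh₂ x)⟩

namespace PathCoordinates

open BPath BVertex

variable {k R : Type} [Field k] [Ring R] [Algebra k R] (φ : PathCoordinates k R)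

/-- The embedding of the regular module into its injective envelope. -/
def coresolution₀ : R →ₗ[R] φ.proj I2 × φ.proj I1 × φ.proj I3 × φ.proj I2 × φ.proj I1 ×
    φ.proj I2 × φ.proj I3 :=
  (LinearMap.toSpanSingleton R _ (φ.projPath I2 p1)).prod <|
    (LinearMap.toSpanSingleton R _ (φ.projPath I1 q1)).prod <|
    (LinearMap.toSpanSingleton R _ (φ.projPath I3 q3)).prod <|
    (LinearMap.toSpanSingleton R _ (φ.projPath I2 p3)).prod <|
    (LinearMap.toSpanSingleton R _ (φ.projPath I1 f1)).prod <|
    (LinearMap.toSpanSingleton R _ (φ.projPath I2 f2)).prod <|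
    (LinearMap.toSpanSingleton R _ (φ.projPath I3 f3))

/-- The first differential of the minimal injective coresolution of the regular module. -/
def coresolution₁ : φ.proj I2 × φ.proj I1 × φ.proj I3 × φ.proj I2 × φ.proj I1 × φ.proj I2 ×
    φ.proj I3 →ₗ[R] φ.proj I3 × φ.proj I2 × φ.proj I1 :=
  ((φ.toModule I2 (φ.projPath I3 bq3)) ∘ₗ LinearMap.fst R _ _).prod <|
    (((φ.toModule I1 (φ.projPath I2 s1)).coprod <|
      (-φ.toModule I3 (φ.projPath I2 s3)) ∘ₗ LinearMap.fst R _ _) ∘ₗ LinearMap.snd R _ _).prod <|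
    (φ.toModule I2 (φ.projPath I1 aq1)) ∘ₗ LinearMap.fst R _ _ ∘ₗ LinearMap.snd R _ _ ∘ₗ
      LinearMap.snd R _ _ ∘ₗ LinearMap.snd R _ _

/-- The second differential of the minimal injective coresolution of the regular module. -/
def coresolution₂ : φ.proj I3 × φ.proj I2 × φ.proj I1 →ₗ[R]
    φ.proj I2 × (φ.proj I1 × φ.proj I3) × φ.proj I2 :=
  (φ.toModule I3 (φ.projPath I2 s3)).prodMap <|
    ((φ.toModule I2 (φ.projPath I1 aq1)).prod (φ.toModule I2 (φ.projPath I3 bq3))).prodMap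
      (φ.toModule I1 (φ.projPath I2 s1))

lemma coresolution₀_injective : Function.Injective φ.coresolution₀ := by
  refine (injective_iff_map_eq_zero _).2 fun x hx ↦ φ.ext ?_
  simp [coresolution₀, Prod.ext_iff, proj_eq_iff, forall_iff, tgt, coord_mul, BPath.mul] at hx ⊢
  grind

lemma ker_coresolution₁ : LinearMap.ker φ.coresolution₁ = LinearMap.range φ.coresolution₀ := by
  refine Submodule.ext fun y ↦ ⟨fun hy ↦ ⟨φ.ofCoords fun
      | e1 => φ.coord p1 y.1
      | r11 => φ.coord s1 y.1
      | r31 => φ.coord s3 y.1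
      | t1 => φ.coord w y.1
      | e3 => φ.coord p3 y.2.2.2.1
      | r13 => φ.coord s1 y.2.2.2.1
      | r33 => φ.coord s3 y.2.2.2.1
      | t3 => φ.coord w y.2.2.2.1
      | e2 => φ.coord q1 y.2.1
      | a => φ.coord aq1 y.2.1
      | p1a => φ.coord u1 y.2.1
      | b => φ.coord bq3 y.2.2.1
      | p3b => φ.coord u3 y.2.2.1
      | f1 => φ.coord f1 y.2.2.2.2.1
      | q1 => φ.coord q1 y.2.2.2.2.1
      | aq1 => φ.coord aq1 y.2.2.2.2.1
      | u1 => φ.coord u1 y.2.2.2.2.1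
      | f2 => φ.coord f2 y.2.2.2.2.2.1
      | p1 => φ.coord p1 y.2.2.2.2.2.1
      | p3 => φ.coord p3 y.2.2.2.2.2.1
      | s1 => φ.coord s1 y.2.2.2.2.2.1
      | s3 => φ.coord s3 y.2.2.2.2.2.1
      | w => φ.coord w y.2.2.2.2.2.1
      | f3 => φ.coord f3 y.2.2.2.2.2.2
      | q3 => φ.coord q3 y.2.2.2.2.2.2
      | bq3 => φ.coord bq3 y.2.2.2.2.2.2
      | u3 => φ.coord u3 y.2.2.2.2.2.2, ?_⟩, ?_⟩
  · rw [LinearMap.mem_ker] at hy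
    simp [coresolution₀, coresolution₁, Prod.ext_iff, proj_eq_iff, forall_iff, tgt, coord_mul,
      BPath.mul] at hy ⊢
    grind
  · rintro ⟨x, rfl⟩
    simp [coresolution₀, coresolution₁, proj_eq_iff, forall_iff, tgt, coord_mul, BPath.mul]

lemma ker_coresolution₂ : LinearMap.ker φ.coresolution₂ = LinearMap.range φ.coresolution₁ := by
  refine Submodule.ext fun y ↦ ⟨fun hy ↦
    ⟨(φ.projOfCoords I2 fun | f2 => φ.coord bq3 y.1 | p3 => φ.coord u3 y.1 | _ => 0,
      φ.projOfCoords I1 fun | f1 => φ.coord s1 y.2.1 | q1 => φ.coord w y.2.1 | _ => 0,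
      φ.projOfCoords I3 fun | f3 => -φ.coord s3 y.2.1 | _ => 0,
      φ.projOfCoords I2 fun | f2 => φ.coord aq1 y.2.2 | p1 => φ.coord u1 y.2.2 | _ => 0,
      0, 0, 0), ?_⟩, ?_⟩
  · rw [LinearMap.mem_ker] at hy
    simp [coresolution₁, coresolution₂, Prod.ext_iff, proj_eq_iff, forall_iff, tgt, coord_mul,
      BPath.mul] at hy ⊢
    grind
  · rintro ⟨x, rfl⟩
    simp [coresolution₁, coresolution₂, proj_eq_iff, forall_iff, tgt, coord_mul, BPath.mul]

theorem isThreeAuslander (φ : PathCoordinates k R) : IsThreeAuslander R :=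
  isThreeAuslander_of_exact φ.coresolution₀_injective φ.ker_coresolution₁ φ.ker_coresolution₂
    φ.modulePdLE_three φ.not_injective

end PathCoordinates

namespace AlgA

variable {k : Type} [Field k]

/-- The class of a generator in `A`. -/
def gen (g : QGen) : AlgA k := RingQuot.mkAlgHom k (ARel k) (FreeAlgebra.ι k g)

lemma gen_e_mul_gen_e (i j : Fin 3) :
    (gen (.e i) * gen (.e j) : AlgA k) = if i = j then gen (.e i) else 0 := by
  have h := RingQuot.mkAlgHom_rel k (ARel.idem (k := k) i j)
  rw [map_mul] at h
  rw [gen, gen, h]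
  split_ifs <;> simp

lemma gen_src_mul_gen_ar (a : Fin 4) :
    (gen (.e (arrowSrc a)) * gen (.ar a) : AlgA k) = gen (.ar a) := by
  rw [gen, gen, ← map_mul]
  exact RingQuot.mkAlgHom_rel k (ARel.src (k := k) a)

lemma gen_ar_mul_gen_tgt (a : Fin 4) :
    (gen (.ar a) * gen (.e (arrowTgt a)) : AlgA k) = gen (.ar a) := by
  rw [gen, gen, ← map_mul]
  exact RingQuot.mkAlgHom_rel k (ARel.tgt (k := k) a)

lemma gen_e_mul_gen_ar (i : Fin 3) (a : Fin 4) :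
    (gen (.e i) * gen (.ar a) : AlgA k) = if i = arrowSrc a then gen (.ar a) else 0 := by
  rw [← gen_src_mul_gen_ar, ← mul_assoc, gen_e_mul_gen_e]
  split_ifs with h <;> simp [h]

lemma gen_ar_mul_gen_e (i : Fin 3) (a : Fin 4) :
    (gen (.ar a) * gen (.e i) : AlgA k) = if arrowTgt a = i then gen (.ar a) else 0 := by
  rw [← gen_ar_mul_gen_tgt, mul_assoc, gen_e_mul_gen_e]
  split_ifs with h <;> simp

lemma gen_ar_mul_gen_ar (a b : Fin 4) : (gen (.ar a) * gen (.ar b) : AlgA k) = 0 := by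
  rw [gen, gen, ← map_mul, RingQuot.mkAlgHom_rel k (ARel.radsq (k := k) a b), map_zero]

lemma sum_gen_e : (gen (.e 0) + gen (.e 1) + gen (.e 2) : AlgA k) = 1 := by
  rw [gen, gen, gen, ← map_add, ← map_add, RingQuot.mkAlgHom_rel k (ARel.sum (k := k)), map_one]

variable (k) in
/-- A faithful matrix representation of `A`. -/
def toMatrix : AlgA k →ₐ[k] Matrix (Fin 3) (Fin 3) (DualNumber k) :=
  RingQuot.liftAlgHom k ⟨FreeAlgebra.lift k fun
    | .e i => Matrix.single i i 1
    | .ar a => Matrix.single (arrowSrc a) (arrowTgt a) DualNumber.eps, by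
      intro _ _ h
      induction h with
      | idem i j =>
          by_cases h : i = j
          · simp [h]
          · simp [h, Matrix.single_mul_single_of_ne]
      | sum =>
          ext i j : 1
          fin_cases i <;> fin_cases j <;> simp [Matrix.single]
      | src a => simp
      | tgt a => simp
      | radsq a b =>
          by_cases h : arrowTgt a = arrowSrc b
          · simp [h]
          · simp [h, Matrix.single_mul_single_of_ne]⟩

/-- The coordinate of an element of `A` at a generator. -/
def coord : QGen → AlgA k →ₗ[k] k
  | .e i => (TrivSqZeroExt.fstHom k k k).toLinearMap ∘ₗ
      (Matrix.entryLinearMap k (DualNumber k) i i) ∘ₗ (toMatrix k).toLinearMap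
  | .ar a => TrivSqZeroExt.sndHom k k ∘ₗ
      (Matrix.entryLinearMap k (DualNumber k) (arrowSrc a) (arrowTgt a)) ∘ₗ (toMatrix k).toLinearMap

lemma toMatrix_gen_e (i : Fin 3) : toMatrix k (gen (.e i)) = Matrix.single i i 1 := by
  simp [toMatrix, gen]

lemma toMatrix_gen_ar (a : Fin 4) :
    toMatrix k (gen (.ar a)) = Matrix.single (arrowSrc a) (arrowTgt a) DualNumber.eps := by
  simp [toMatrix, gen]

lemma coord_e_gen_e (i j : Fin 3) :
    coord (.e i) (gen (.e j) : AlgA k) = if i = j then 1 else 0 := by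
  fin_cases i <;> fin_cases j <;> simp [coord, toMatrix_gen_e, Matrix.single]

lemma coord_e_gen_ar (i : Fin 3) (a : Fin 4) : coord (.e i) (gen (.ar a) : AlgA k) = 0 := by
  fin_cases i <;> fin_cases a <;>
    simp [coord, toMatrix_gen_ar, Matrix.single, arrowSrc, arrowTgt]

lemma coord_ar_gen_e (i : Fin 3) (a : Fin 4) : coord (.ar a) (gen (.e i) : AlgA k) = 0 := by
  fin_cases i <;> fin_cases a <;>
    simp [coord, toMatrix_gen_e, Matrix.single, arrowSrc, arrowTgt]

lemma coord_ar_gen_ar (a b : Fin 4) :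
    coord (.ar a) (gen (.ar b) : AlgA k) = if a = b then 1 else 0 := by
  fin_cases a <;> fin_cases b <;>
    simp [coord, toMatrix_gen_ar, Matrix.single, arrowSrc, arrowTgt]

lemma span_range_gen : Submodule.span k (Set.range (gen (k := k))) = ⊤ := by
  set S := Submodule.span k (Set.range (gen (k := k))) with hS
  have hgen (g : QGen) : gen g ∈ S := Submodule.subset_span ⟨g, rfl⟩
  have h1 : (1 : AlgA k) ∈ S := by
    rw [← sum_gen_e]
    exact S.add_mem (S.add_mem (hgen _) (hgen _)) (hgen _)
  have hmul : S * S ≤ S := by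
    rw [hS, Submodule.span_mul_span, Submodule.span_le]
    rintro _ ⟨_, ⟨g, rfl⟩, _, ⟨h, rfl⟩, rfl⟩
    rw [← hS]
    cases g <;> cases h <;> simp only [gen_e_mul_gen_e, gen_e_mul_gen_ar, gen_ar_mul_gen_e,
      gen_ar_mul_gen_ar, SetLike.mem_coe] <;> try split_ifs
    all_goals simp [hgen]
  refine (Submodule.eq_top_iff').2 fun x ↦ ?_
  obtain ⟨x, rfl⟩ := RingQuot.mkAlgHom_surjective k (ARel k) x
  induction x using FreeAlgebra.induction with
  | grade0 c =>
    rw [AlgHom.commutes, Algebra.algebraMap_eq_smul_one]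
    exact S.smul_mem c h1
  | grade1 g => exact hgen g
  | mul x y hx hy =>
    rw [map_mul]
    exact hmul (Submodule.mul_mem_mul hx hy)
  | add x y hx hy =>
    rw [map_add]
    exact S.add_mem hx hy

lemma linearMap_ext {N : Type} [AddCommGroup N] [Module k N] {f g : AlgA k →ₗ[k] N}
    (h : ∀ x, f (gen x) = g (gen x)) : f = g :=
  LinearMap.ext_on_range span_range_gen h

lemma eq_sum (x : AlgA k) : x = coord (.e 0) x • gen (.e 0) + coord (.e 1) x • gen (.e 1) +
    coord (.e 2) x • gen (.e 2) + coord (.ar 0) x • gen (.ar 0) + coord (.ar 1) x • gen (.ar 1) +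
    coord (.ar 2) x • gen (.ar 2) + coord (.ar 3) x • gen (.ar 3) := by
  let f : AlgA k →ₗ[k] AlgA k := (coord (.e 0)).smulRight (gen (.e 0)) +
    (coord (.e 1)).smulRight (gen (.e 1)) + (coord (.e 2)).smulRight (gen (.e 2)) +
    (coord (.ar 0)).smulRight (gen (.ar 0)) + (coord (.ar 1)).smulRight (gen (.ar 1)) +
    (coord (.ar 2)).smulRight (gen (.ar 2)) + (coord (.ar 3)).smulRight (gen (.ar 3))
  have h : LinearMap.id = f := by
    refine linearMap_ext fun g ↦ ?_
    obtain i | a := g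
    · fin_cases i <;> simp [f, coord_e_gen_e, coord_ar_gen_e]
    · fin_cases a <;> simp [f, coord_e_gen_ar, coord_ar_gen_ar]
  exact LinearMap.congr_fun h x

lemma coord_e_mul (i : Fin 3) (x y : AlgA k) :
    coord (.e i) (x * y) = coord (.e i) x * coord (.e i) y := by
  rw [eq_sum x, eq_sum y]
  fin_cases i <;> simp [add_mul, mul_add, gen_e_mul_gen_e, gen_e_mul_gen_ar, gen_ar_mul_gen_e,
    gen_ar_mul_gen_ar, coord_e_gen_e, coord_e_gen_ar, arrowSrc, arrowTgt, mul_comm]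

lemma mul_gen_ar (x : AlgA k) (a : Fin 4) :
    x * gen (.ar a) = coord (.e (arrowSrc a)) x • gen (.ar a) := by
  conv_lhs => rw [eq_sum x]
  fin_cases a <;> simp [add_mul, gen_e_mul_gen_ar, gen_ar_mul_gen_ar, arrowSrc]

lemma mul_gen_e (x : AlgA k) (i : Fin 3) : x * gen (.e i) = coord (.e i) x • gen (.e i) +
    ∑ a, if arrowTgt a = i then coord (.ar a) x • gen (.ar a) else 0 := by
  conv_lhs => rw [eq_sum x]
  fin_cases i <;> simp [add_mul, gen_e_mul_gen_e, gen_ar_mul_gen_e, arrowTgt, Fin.sum_univ_four,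
    add_assoc]

lemma coord_ar_mul (a : Fin 4) (x y : AlgA k) : coord (.ar a) (x * y) =
    coord (.e (arrowSrc a)) x * coord (.ar a) y +
      coord (.ar a) x * coord (.e (arrowTgt a)) y := by
  conv_lhs => rw [eq_sum y]
  fin_cases a <;> simp [mul_add, mul_gen_ar, mul_gen_e, coord_ar_gen_e, coord_ar_gen_ar,
    arrowSrc, arrowTgt, Fin.sum_univ_four] <;> ring

lemma smul_dual_apply (a : Aop k) (ψ : DualA k) (x : AlgA k) : (a • ψ) x = ψ (a.unop * x) := rfl

instance : SMulCommClass (Aop k) k (DualA k) where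
  smul_comm _ _ _ := rfl

instance : IsScalarTower k (Aop k) (DualA k) where
  smul_assoc c a ψ := by
    ext x
    simp [smul_dual_apply]


/-- The element of `A ⊕ D(A)` with given coordinates. -/
def ofCoords (x ψ : QGen → k) : MA k :=
  (∑ i, x (.e i) • gen (.e i) + ∑ a, x (.ar a) • gen (.ar a),
    ∑ i, ψ (.e i) • coord (.e i) + ∑ a, ψ (.ar a) • coord (.ar a))

lemma coord_ofCoords_fst (x ψ : QGen → k) (g : QGen) : coord g (ofCoords x ψ).1 = x g := by
  cases g <;> simp [ofCoords, coord_e_gen_e, coord_e_gen_ar, coord_ar_gen_e, coord_ar_gen_ar]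

lemma ofCoords_snd_gen (x ψ : QGen → k) (g : QGen) : (ofCoords x ψ).2 (gen g) = ψ g := by
  cases g <;> simp [ofCoords, coord_e_gen_e, coord_e_gen_ar, coord_ar_gen_e, coord_ar_gen_ar]

lemma forall_qGen {P : QGen → Prop} : (∀ g, P g) ↔ (P (.e 0) ∧ P (.e 1) ∧ P (.e 2)) ∧
    P (.ar 0) ∧ P (.ar 1) ∧ P (.ar 2) ∧ P (.ar 3) := by
  refine ⟨fun h ↦ by simp [h], fun h g ↦ ?_⟩
  obtain i | a := g
  · fin_cases i <;> simp [h]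
  · fin_cases a <;> simp [h]

lemma prod_ext {m n : MA k} (h₁ : ∀ g, coord g m.1 = coord g n.1)
    (h₂ : ∀ g, m.2 (gen g) = n.2 (gen g)) : m = n := by
  refine Prod.ext ?_ (linearMap_ext h₂)
  rw [eq_sum m.1, eq_sum n.1]
  simp only [h₁]


/-- The endomorphism of `A ⊕ D(A)` with given path coordinates. -/
def endOfCoords (c : BPath → k) : EndB k where
  toFun m := ofCoords
    (fun
      | .e i => coord (.e i) m.1 * ![c .e1, c .e2, c .e3] i
      | .ar a => ![
        coord (.e 1) m.1 * c .t1 + m.2 (gen (.ar 1)) * c .r11 + m.2 (gen (.ar 2)) * c .r31 +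
          coord (.ar 0) m.1 * c .e1,
        coord (.e 0) m.1 * c .p1a + m.2 (gen (.ar 0)) * c .a + coord (.ar 1) m.1 * c .e2,
        coord (.e 2) m.1 * c .p3b + m.2 (gen (.ar 3)) * c .b + coord (.ar 2) m.1 * c .e2,
        coord (.e 1) m.1 * c .t3 + m.2 (gen (.ar 1)) * c .r13 + m.2 (gen (.ar 2)) * c .r33 +
          coord (.ar 3) m.1 * c .e3] a)
    (fun
      | .e i => ![
        coord (.e 0) m.1 * c .u1 + m.2 (gen (.ar 0)) * c .aq1 + coord (.ar 1) m.1 * c .q1 +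
          m.2 (gen (.e 0)) * c .f1,
        coord (.e 1) m.1 * c .w + m.2 (gen (.ar 1)) * c .s1 + m.2 (gen (.ar 2)) * c .s3 +
          coord (.ar 0) m.1 * c .p1 + coord (.ar 3) m.1 * c .p3 + m.2 (gen (.e 1)) * c .f2,
        coord (.e 2) m.1 * c .u3 + m.2 (gen (.ar 3)) * c .bq3 + coord (.ar 2) m.1 * c .q3 +
          m.2 (gen (.e 2)) * c .f3] i
      | .ar a => ![
        coord (.e 0) m.1 * c .p1 + m.2 (gen (.ar 0)) * c .f2,
        coord (.e 1) m.1 * c .q1 + m.2 (gen (.ar 1)) * c .f1,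
        coord (.e 1) m.1 * c .q3 + m.2 (gen (.ar 2)) * c .f3,
        coord (.e 2) m.1 * c .p3 + m.2 (gen (.ar 3)) * c .f2] a)
  map_add' m n := by
    refine prod_ext (forall_qGen.2 ?_) (forall_qGen.2 ?_) <;>
      simp [coord_ofCoords_fst, ofCoords_snd_gen] <;> grind
  map_smul' x m := by
    refine prod_ext (forall_qGen.2 ?_) (forall_qGen.2 ?_) <;>
      simp [coord_ofCoords_fst, ofCoords_snd_gen, smul_dual_apply, mul_gen_ar, mul_gen_e,
        coord_ar_mul, coord_e_mul, arrowSrc, arrowTgt, Fin.sum_univ_four] <;> grind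

lemma endOfCoords_mul (c d : BPath → k) :
    endOfCoords d * endOfCoords c = endOfCoords (BPath.mul c d) := by
  refine LinearMap.ext fun m ↦ prod_ext (forall_qGen.2 ?_) (forall_qGen.2 ?_) <;>
    simp [endOfCoords, coord_ofCoords_fst, ofCoords_snd_gen, BPath.mul] <;> grind

/-- The path coordinates of an endomorphism of `A ⊕ D(A)`. -/
noncomputable def pathCoord (f : EndB k) : BPath → k
  | .e1 => coord (.e 0) (f (gen (.e 0), 0)).1
  | .p1a => coord (.ar 1) (f (gen (.e 0), 0)).1
  | .u1 => (f (gen (.e 0), 0)).2 (gen (.e 0))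
  | .p1 => (f (gen (.e 0), 0)).2 (gen (.ar 0))
  | .e2 => coord (.e 1) (f (gen (.e 1), 0)).1
  | .t1 => coord (.ar 0) (f (gen (.e 1), 0)).1
  | .t3 => coord (.ar 3) (f (gen (.e 1), 0)).1
  | .w => (f (gen (.e 1), 0)).2 (gen (.e 1))
  | .q1 => (f (gen (.e 1), 0)).2 (gen (.ar 1))
  | .q3 => (f (gen (.e 1), 0)).2 (gen (.ar 2))
  | .e3 => coord (.e 2) (f (gen (.e 2), 0)).1
  | .p3b => coord (.ar 2) (f (gen (.e 2), 0)).1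
  | .u3 => (f (gen (.e 2), 0)).2 (gen (.e 2))
  | .p3 => (f (gen (.e 2), 0)).2 (gen (.ar 3))
  | .a => coord (.ar 1) (f (0, coord (.ar 0))).1
  | .aq1 => (f (0, coord (.ar 0))).2 (gen (.e 0))
  | .f2 => (f (0, coord (.ar 0))).2 (gen (.ar 0))
  | .b => coord (.ar 2) (f (0, coord (.ar 3))).1
  | .bq3 => (f (0, coord (.ar 3))).2 (gen (.e 2))
  | .r11 => coord (.ar 0) (f (0, coord (.ar 1))).1
  | .r13 => coord (.ar 3) (f (0, coord (.ar 1))).1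
  | .s1 => (f (0, coord (.ar 1))).2 (gen (.e 1))
  | .f1 => (f (0, coord (.ar 1))).2 (gen (.ar 1))
  | .r31 => coord (.ar 0) (f (0, coord (.ar 2))).1
  | .r33 => coord (.ar 3) (f (0, coord (.ar 2))).1
  | .s3 => (f (0, coord (.ar 2))).2 (gen (.e 1))
  | .f3 => (f (0, coord (.ar 2))).2 (gen (.ar 2))

lemma pathCoord_endOfCoords (c : BPath → k) : pathCoord (endOfCoords c) = c := by
  funext p
  cases p <;> simp [pathCoord, endOfCoords, coord_ofCoords_fst, ofCoords_snd_gen, coord_e_gen_e,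
    coord_ar_gen_e, coord_ar_gen_ar]

lemma end_ext {f g : EndB k} (he : ∀ i, f (gen (.e i), 0) = g (gen (.e i), 0))
    (ha : ∀ a, f (0, coord (.ar a)) = g (0, coord (.ar a))) : f = g := by
  refine LinearMap.ext fun m ↦ ?_
  have hm : m = ∑ i, MulOpposite.op m.1 • ((gen (.e i), 0) : MA k) +
      ∑ a, MulOpposite.op (m.2 (gen (.ar a)) • (gen (.e (arrowSrc a)) : AlgA k) +
        if a = 3 then 0 else m.2 (gen (.e (arrowTgt a))) • gen (.ar a)) •
          ((0, coord (.ar a)) : MA k) := by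
    refine prod_ext (forall_qGen.2 ?_) (forall_qGen.2 ?_) <;>
      simp [Fin.sum_univ_four, Fin.sum_univ_three, coord_e_mul, coord_ar_mul, coord_e_gen_e,
        coord_ar_gen_e, coord_e_gen_ar, coord_ar_gen_ar, arrowSrc, arrowTgt, smul_dual_apply]
  rw [hm]
  simp only [map_add, map_sum, map_smul, he, ha]

lemma endOfCoords_pathCoord_e (f : EndB k) (i : Fin 3) :
    endOfCoords (pathCoord f) (gen (.e i), 0) = f (gen (.e i), 0) := by
  have he : f (gen (.e i), 0) = MulOpposite.op (gen (.e i) : AlgA k) • f (gen (.e i), 0) := by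
    rw [← map_smul]
    congr 1
    simp [Prod.smul_mk, gen_e_mul_gen_e]
  have h₁ := forall_qGen.1 fun g ↦ congrArg (fun m ↦ coord g m.1) he
  have h₂ := forall_qGen.1 fun g ↦ congrArg (fun m ↦ m.2 (gen g)) he
  clear he
  simp only [Prod.smul_fst, Prod.smul_snd, MulOpposite.smul_eq_mul_unop, smul_dual_apply,
    MulOpposite.unop_op, coord_e_mul, coord_ar_mul, coord_e_gen_e, coord_ar_gen_e,
    gen_e_mul_gen_e, gen_e_mul_gen_ar] at h₁ h₂
  refine prod_ext (forall_qGen.2 ?_) (forall_qGen.2 ?_)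
  · clear h₂
    fin_cases i <;> simp [endOfCoords, pathCoord, coord_ofCoords_fst, coord_e_gen_e,
      coord_ar_gen_e]
    all_goals simp [arrowTgt] at h₁; grind
  · clear h₁
    fin_cases i <;> simp [endOfCoords, pathCoord, ofCoords_snd_gen, coord_e_gen_e,
      coord_ar_gen_e]
    all_goals simp [arrowSrc] at h₂; grind

/-- The socle of `D(A)` at the vertex `2` is generated by either of the arrows ending there. -/
lemma op_smul_coord_ar_zero : MulOpposite.op (gen (.ar 0) : AlgA k) • ((0, coord (.ar 0)) : MA k) =
    MulOpposite.op (gen (.ar 3) : AlgA k) • (0, coord (.ar 3)) := by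
  refine prod_ext (by simp) fun g ↦ ?_
  simp [smul_dual_apply, coord_ar_mul, coord_e_gen_ar, coord_ar_gen_ar, arrowTgt]

lemma op_smul_coord_ar_of_ne {a b : Fin 4} (hab : a ≠ b) :
    MulOpposite.op (gen (.ar b) : AlgA k) • ((0, coord (.ar a)) : MA k) = 0 := by
  refine prod_ext (by simp) fun g ↦ ?_
  simp [smul_dual_apply, coord_ar_mul, coord_e_gen_ar, coord_ar_gen_ar, hab]

lemma op_gen_arrowSrc_smul_coord_ar (a : Fin 4) :
    MulOpposite.op (gen (.e (arrowSrc a)) : AlgA k) • ((0, coord (.ar a)) : MA k) =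
      (0, coord (.ar a)) := by
  refine prod_ext (by simp) fun g ↦ ?_
  simp [smul_dual_apply, coord_ar_mul, coord_e_gen_e, coord_ar_gen_e]

lemma op_smul_apply_coord_ar_zero (f : EndB k) :
    MulOpposite.op (gen (.ar 0) : AlgA k) • f (0, coord (.ar 0)) =
      MulOpposite.op (gen (.ar 3) : AlgA k) • f (0, coord (.ar 3)) := by
  rw [← map_smul, ← map_smul, op_smul_coord_ar_zero]

lemma op_smul_apply_coord_ar_of_ne (f : EndB k) {a b : Fin 4} (hab : a ≠ b) :
    MulOpposite.op (gen (.ar b) : AlgA k) • f (0, coord (.ar a)) = 0 := by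
  rw [← map_smul, op_smul_coord_ar_of_ne hab, map_zero]

lemma op_gen_arrowSrc_smul_apply_coord_ar (f : EndB k) (a : Fin 4) :
    MulOpposite.op (gen (.e (arrowSrc a)) : AlgA k) • f (0, coord (.ar a)) =
      f (0, coord (.ar a)) := by
  rw [← map_smul, op_gen_arrowSrc_smul_coord_ar]

lemma coord_e_apply_coord_ar_of_ne (f : EndB k) {a b : Fin 4} (hab : a ≠ b) :
    coord (.e (arrowSrc b)) (f (0, coord (.ar a))).1 = 0 := by
  simpa [coord_ar_mul, coord_ar_gen_ar, coord_e_gen_ar] using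
    congrArg (fun m ↦ coord (.ar b) m.1) (op_smul_apply_coord_ar_of_ne f hab)

lemma coord_e_apply_coord_ar (f : EndB k) (a : Fin 4) (i : Fin 3) :
    coord (.e i) (f (0, coord (.ar a))).1 = 0 := by
  by_cases h : ∃ b, a ≠ b ∧ arrowSrc b = i
  · obtain ⟨b, hab, rfl⟩ := h
    exact coord_e_apply_coord_ar_of_ne f hab
  · obtain ⟨rfl, rfl⟩ | ⟨rfl, rfl⟩ : (a = 0 ∧ i = 0) ∨ (a = 3 ∧ i = 2) := by
      revert a i
      decide
    · simpa [coord_ar_mul, coord_ar_gen_ar, coord_e_gen_ar, arrowSrc] using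
        congrArg (fun m ↦ coord (.ar 0) m.1) (op_smul_apply_coord_ar_zero f)
    · simpa [coord_ar_mul, coord_ar_gen_ar, coord_e_gen_ar, arrowSrc] using
        (congrArg (fun m ↦ coord (.ar 3) m.1) (op_smul_apply_coord_ar_zero f)).symm

lemma coord_ar_apply_coord_ar (f : EndB k) {a b : Fin 4} (h : arrowTgt b ≠ arrowSrc a) :
    coord (.ar b) (f (0, coord (.ar a))).1 = 0 := by
  rw [← op_gen_arrowSrc_smul_apply_coord_ar]
  simp [coord_ar_mul, coord_ar_gen_e, coord_e_gen_e, h]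

lemma apply_coord_ar_gen_e (f : EndB k) {a : Fin 4} {i : Fin 3} (h : i ≠ arrowSrc a) :
    (f (0, coord (.ar a))).2 (gen (.e i)) = 0 := by
  rw [← op_gen_arrowSrc_smul_apply_coord_ar]
  simp [smul_dual_apply, gen_e_mul_gen_e, h.symm]

lemma apply_coord_ar_gen_ar (f : EndB k) {a b : Fin 4} (h : a ≠ b) :
    (f (0, coord (.ar a))).2 (gen (.ar b)) = 0 := by
  simpa [smul_dual_apply, gen_ar_mul_gen_e] using
    congrArg (fun m ↦ m.2 (gen (.e (arrowTgt b)))) (op_smul_apply_coord_ar_of_ne f h)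

lemma apply_coord_ar_three (f : EndB k) : (f (0, coord (.ar 3))).2 (gen (.ar 3)) =
    (f (0, coord (.ar 0))).2 (gen (.ar 0)) := by
  simpa [smul_dual_apply, gen_ar_mul_gen_e, arrowTgt] using
    (congrArg (fun m ↦ m.2 (gen (.e 1))) (op_smul_apply_coord_ar_zero f)).symm

lemma endOfCoords_pathCoord_ar (f : EndB k) (a : Fin 4) :
    endOfCoords (pathCoord f) (0, coord (.ar a)) = f (0, coord (.ar a)) := by
  refine prod_ext (forall_qGen.2 ?_) (forall_qGen.2 ?_)
  · fin_cases a <;> simp [endOfCoords, pathCoord, coord_ofCoords_fst, coord_ar_gen_ar,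
      coord_e_apply_coord_ar]
    all_goals constructorm* _ ∧ _
    all_goals exact (coord_ar_apply_coord_ar f (by decide)).symm
  · fin_cases a <;> simp [endOfCoords, pathCoord, ofCoords_snd_gen, coord_ar_gen_ar,
      coord_ar_gen_e, apply_coord_ar_gen_ar, apply_coord_ar_three]
    all_goals exact ⟨(apply_coord_ar_gen_e f (by decide)).symm,
      (apply_coord_ar_gen_e f (by decide)).symm⟩

lemma endOfCoords_pathCoord (f : EndB k) : endOfCoords (pathCoord f) = f :=
  end_ext (endOfCoords_pathCoord_e f) (endOfCoords_pathCoord_ar f)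

variable (k) in
/-- The path coordinates on `B`. -/
noncomputable def pathCoordinates : PathCoordinates k (Bop k) where
  toFun f := pathCoord f.unop
  invFun c := MulOpposite.op (endOfCoords c)
  left_inv f := by simp [endOfCoords_pathCoord]
  right_inv c := by simp [pathCoord_endOfCoords]
  map_add' f g := by
    funext p
    cases p <;> simp [pathCoord]
  map_smul' c f := by
    funext p
    cases p <;> simp [pathCoord]
  map_mul' f g := by
    change pathCoord (g.unop * f.unop) = BPath.mul (pathCoord f.unop) (pathCoord g.unop)
    conv_lhs => rw [← endOfCoords_pathCoord f.unop, ← endOfCoords_pathCoord g.unop,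
      endOfCoords_mul, pathCoord_endOfCoords]

end AlgA

/-- The endomorphism algebra `B = End_A(A ⊕ D(A))` is a higher Auslander algebra:
its global dimension is `3`, and in every minimal injective coresolution
`0 → B → I⁰ → I¹ → I² → ⋯` of the regular right `B`-module the terms `I⁰`, `I¹`,
`I²` are projective while `I³` is not (so the dominant dimension is also `3`).
Minimality is expressed by requiring the image of each map to be essential.
The regular right `B`-module is the left regular `Bᵐᵒᵖ`-module `Bop k`. -/
theorem endB_is_higher_auslander (k : Type) [Field k] :
    ((∀ X Y : ModuleCat (Bop k), Subsingleton (ExtB k X Y 4)) ∧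
      (∃ X Y : ModuleCat (Bop k), Nontrivial (ExtB k X Y 3))) ∧
    (∀ (I : ℕ → Type) [∀ n, AddCommGroup (I n)] [∀ n, Module (Bop k) (I n)]
        (ε : Bop k →ₗ[Bop k] I 0) (d : ∀ n, I n →ₗ[Bop k] I (n + 1)),
        (∀ n, Module.Injective (Bop k) (I n)) →
        Function.Injective ε →
        LinearMap.ker (d 0) = LinearMap.range ε →
        (∀ n, LinearMap.ker (d (n + 1)) = LinearMap.range (d n)) →
        EssentialRange (R := Bop k) (M := Bop k) (N := I 0) ε →
        (∀ n, EssentialRange (R := Bop k) (M := I n) (N := I (n + 1)) (d n)) →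
        Module.Projective (Bop k) (I 0) ∧ Module.Projective (Bop k) (I 1) ∧
          Module.Projective (Bop k) (I 2) ∧ ¬ Module.Projective (Bop k) (I 3)) :=
  (AlgA.pathCoordinates k).isThreeAuslander
end
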